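/- arXiv:2210.13649 — 8 statements merged into one kernel-verified Lean document; each statement's English description precedes it below -/
import Mathlib

section
/- Let η : ℝ → ℝ be locally integrable with η(x) > 0 for almost every x, and define γ(x) = ∫₀ˣ η(s) ds. Then γ is continuous and strictly increasing on ℝ (hence injective, a homeomorphism onto its range), and for every Lebesgue-null set A ⊆ ℝ, the preimage γ⁻¹(A) = {x : γ(x) ∈ A} is also Lebesgue-null. In particular the inverse function of γ maps null subsets of the range of γ to null sets (the Lusin N-property), so the inverse of γ is absolutely continuous on compact subintervals of the range of γ. -/
open MeasureTheory

/-- if `η` is locally integrable and a.e. positive, then its primitive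
`γ(x) = ∫₀ˣ η` is continuous and strictly increasing (hence injective), and the
preimage under `γ` of every Lebesgue-null set is Lebesgue-null (equivalently, the
inverse of `γ` has the Lusin N-property, hence is absolutely continuous on compact
subintervals of the range of `γ`). -/
theorem stmt3 (η : ℝ → ℝ) (hloc : LocallyIntegrable η volume)
    (hpos : ∀ᵐ x : ℝ ∂volume, 0 < η x) :
    Continuous (fun x => ∫ s in (0 : ℝ)..x, η s) ∧
    StrictMono (fun x => ∫ s in (0 : ℝ)..x, η s) ∧
    Function.Injective (fun x => ∫ s in (0 : ℝ)..x, η s) ∧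
    ∀ A : Set ℝ, volume A = 0 →
      volume ((fun x => ∫ s in (0 : ℝ)..x, η s) ⁻¹' A) = 0 := by
  have hii : ∀ a b : ℝ, IntervalIntegrable η volume a b := fun a b =>
    (hloc.integrableOn_isCompact isCompact_uIcc).intervalIntegrable
  have hcont : Continuous (fun x => ∫ s in (0 : ℝ)..x, η s) :=
    intervalIntegral.continuous_primitive hii 0
  have hmono : StrictMono (fun x => ∫ s in (0 : ℝ)..x, η s) := by
    intro a b hab
    have h1 := intervalIntegral.integral_interval_sub_left (hii 0 b) (hii 0 a)
    have h2 : 0 < ∫ s in a..b, η s := by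
      rw [intervalIntegral.integral_pos_iff_support_of_nonneg_ae
        (hpos.mono fun x hx => hx.le) (hii a b)]
      refine ⟨hab, ?_⟩
      have : (Function.support η ∩ Set.Ioc a b : Set ℝ) =ᵐ[volume] Set.Ioc a b := by
        filter_upwards [hpos] with x hx
        apply propext
        change (x ∈ Function.support η ∧ x ∈ Set.Ioc a b) ↔ x ∈ Set.Ioc a b
        simp [hx.ne']
      rw [measure_congr this]
      simpa using hab
    simp only
    linarith
  refine ⟨hcont, hmono, hmono.injective, ?_⟩
  intro A hA
  set γ : ℝ → ℝ := fun x => ∫ s in (0 : ℝ)..x, η s with hγ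
  have hder : ∀ᵐ x : ℝ ∂volume, HasDerivAt γ (η x) x := by
    filter_upwards [_root_.LocallyIntegrable.ae_hasDerivAt_integral hloc] with x hx
    exact hx 0
  have hgood := hder.and hpos
  set N := toMeasurable volume {x | ¬ (HasDerivAt γ (η x) x ∧ 0 < η x)} with hN
  have hN0 : volume N = 0 := by rw [hN, measure_toMeasurable]; exact hgood
  have hNg : ∀ x ∉ N, HasDerivAt γ (η x) x ∧ 0 < η x := by
    intro x hx
    by_contra h
    exact hx (subset_toMeasurable _ _ h)
  set B := γ ⁻¹' (toMeasurable volume A) \ N with hB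
  have hBm : MeasurableSet B :=
    (hcont.measurable (measurableSet_toMeasurable _ _)).diff (measurableSet_toMeasurable _ _)
  have him : volume (γ '' B) = 0 := by
    refine measure_mono_null (t := toMeasurable volume A) ?_ (by rwa [measure_toMeasurable])
    rintro _ ⟨x, hx, rfl⟩
    exact hx.1
  have hint := lintegral_image_eq_lintegral_abs_deriv_mul hBm
    (fun x hx => (hNg x hx.2).1.hasDerivWithinAt) hmono.injective.injOn (fun _ => 1)
  have hB0 : volume B = 0 := by
    simp only [mul_one, lintegral_one, Measure.restrict_apply_univ, him] at hint
    have hm : AEMeasurable (fun x => ENNReal.ofReal |η x|) (volume.restrict B) :=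
      (hloc.aestronglyMeasurable.aemeasurable.restrict.abs).ennreal_ofReal
    have hz := (lintegral_eq_zero_iff' hm).1 hint.symm
    have hf : ∀ᵐ x ∂(volume.restrict B), False := by
      filter_upwards [hz, ae_restrict_of_ae hpos] with x hx hx'
      have h3 : |η x| ≤ 0 := ENNReal.ofReal_eq_zero.1 hx
      exact absurd (abs_nonpos_iff.1 h3) (ne_of_gt hx')
    simpa [ae_iff] using hf
  refine measure_mono_null (t := B ∪ N) ?_ (measure_union_null hB0 hN0)
  intro x hx
  by_cases h : x ∈ N
  · exact Or.inr h
  · exact Or.inl ⟨subset_toMeasurable _ _ hx, h⟩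
end

section
/- Let 0 < m ≤ M, let G : (0,∞) → ℝ be twice continuously differentiable with G' > 0 on [m, M], and set g(s) = s·G(s). Let σ₀ : ℝ → [m, M] be measurable, and let η, v : ℝ × [0, ∞) → ℝ be bounded measurable with 0 < m' ≤ η ≤ M' and m ≤ v/η ≤ M, satisfying the weak formulation: for every test function φ, ∫₀^∞ ∫_ℝ (∂_t φ·η − ∂_x φ·G(v/η)) dx dt + ∫_ℝ φ(x,0) dx = 0 and ∫₀^∞ ∫_ℝ ∂_t φ·v dx dt + ∫_ℝ φ(x,0)·σ₀(x) dx = 0. Let γ : ℝ × [0, ∞) → ℝ be locally Lipschitz with γ(x,0) = x, such that for each t the map x ↦ γ(x,t) is a strictly increasing bijection of ℝ onto ℝ, and such that ∂_x γ(x,t) = η(x,t) and ∂_t γ(x,t) = G(v(x,t)/η(x,t)) for almost every (x,t). Define σ(y,t) = v(γ(·,t)⁻¹(y), t) / η(γ(·,t)⁻¹(y), t). Then σ is a weak solution of the scalar conservation law σ_t + g(σ)_x = 0 with initial data σ₀: for every test function φ, ∫₀^∞ ∫_ℝ (∂_t φ(y,t)·σ(y,t) + ∂_x φ(y,t)·g(σ(y,t)))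 dy dt + ∫_ℝ φ(y,0)·σ₀(y) dy = 0. -/
open MeasureTheory
open Set Filter Topology

lemma aux_restrict : (volume.restrict {p : ℝ × ℝ | 0 < p.2}) =
    (volume : Measure ℝ).prod (volume.restrict (Ioi (0:ℝ))) := by
  have h : {p : ℝ × ℝ | 0 < p.2} = univ ×ˢ Ioi (0:ℝ) := by ext; simp
  rw [h, Measure.volume_eq_prod, ← Measure.prod_restrict, Measure.restrict_univ]

lemma aux_supp (φ : ℝ × ℝ → ℝ) (hs : HasCompactSupport φ) :
    ∃ R : ℝ, 0 < R ∧ ∀ p, p ∈ tsupport φ → |p.1| < R ∧ |p.2| < R := by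
  obtain ⟨R, hR⟩ := hs.isCompact.isBounded.subset_closedBall (0 : ℝ × ℝ)
  refine ⟨|R| + 1, by positivity, fun p hp => ?_⟩
  have := hR hp
  rw [mem_closedBall_zero_iff, Prod.norm_def, max_le_iff] at this
  simp only [Real.norm_eq_abs] at this
  have := le_abs_self R
  constructor <;> linarith [this]

noncomputable def auxPhi (φ : ℝ × ℝ → ℝ) (p : ℝ × ℝ) : ℝ := ∫ s in Ioi (0:ℝ), φ (p.1, p.2 + s)

lemma auxPhi_contDiff (φ : ℝ × ℝ → ℝ) (hs : HasCompactSupport φ) (hφ : ContDiff ℝ 1 φ) :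
    ContDiff ℝ 1 (auxPhi φ) := by
  have hm : Measurable (fun s : ℝ => ((0:ℝ), -s)) := by fun_prop
  let μ : Measure (ℝ × ℝ) := Measure.map (fun s : ℝ => ((0:ℝ), -s)) (volume.restrict (Ioi 0))
  have hli : LocallyIntegrable (fun _ : ℝ × ℝ => (1:ℝ)) μ := by
    rw [locallyIntegrable_iff]
    intro K hK
    rw [integrableOn_const_iff]
    right
    rw [Measure.map_apply hm hK.measurableSet]
    refine lt_of_le_of_lt (Measure.restrict_apply_le _ _) ?_
    refine lt_of_le_of_lt (measure_mono ?_) ((hK.image (f := fun p : ℝ × ℝ => - p.2) (by fun_prop)).measure_lt_top)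
    intro s hs
    exact ⟨_, hs, by simp⟩
  have := HasCompactSupport.contDiff_convolution_right (n := 1) (ContinuousLinearMap.mul ℝ ℝ) hs hli (by exact_mod_cast hφ)
  convert! this using 1
  ext p
  simp only [auxPhi, convolution, μ]
  rw [integral_map hm.aemeasurable]
  · simp [Prod.sub_def]
  · apply Continuous.aestronglyMeasurable
    have := hφ.continuous
    simp
    fun_prop

lemma aux_slice_int (φ : ℝ × ℝ → ℝ) (hs : HasCompactSupport φ) (hφ : Continuous φ) (x : ℝ) :
    Integrable (fun t => φ (x, t)) := by
  apply Continuous.integrable_of_hasCompactSupport (by fun_prop)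
  obtain ⟨R, hR, h⟩ := aux_supp φ hs
  apply HasCompactSupport.intro (isCompact_Icc (a := -R) (b := R))
  intro t ht
  by_contra h0
  have := h _ (subset_tsupport φ h0)
  exact ht (abs_le.1 this.2.le)

lemma auxPhi_deriv (φ : ℝ × ℝ → ℝ) (hs : HasCompactSupport φ) (hφ : Continuous φ) (x t : ℝ) :
    HasDerivAt (fun t => auxPhi φ (x, t)) (-φ (x,t)) t := by
  have hi := aux_slice_int φ hs hφ x
  have : (fun t => auxPhi φ (x, t)) = fun t => (∫ s in Ioi (0:ℝ), φ (x, s)) - ∫ s in (0:ℝ)..t, φ (x, s) := by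
    ext t
    have h1 := intervalIntegral.integral_interval_add_Ioi (a := 0) (b := t) hi.integrableOn hi.integrableOn
    rw [← h1]
    simp only [auxPhi, add_sub_cancel_left]
    have := (measurePreserving_add_left volume t).setIntegral_preimage_emb
      (measurableEmbedding_addLeft t) (fun s => φ (x, s)) (Ioi t)
    simpa using this
  rw [this]
  have hc : Continuous (fun s => φ (x, s)) := by fun_prop
  have := intervalIntegral.integral_hasDerivAt_right (a := 0) (b := t) (hc.intervalIntegrable _ _) (hc.stronglyMeasurableAtFilter _ _) hc.continuousAt
  simpa using (this.const_sub (∫ s in Ioi (0:ℝ), φ (x, s)))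

lemma aux_v_eq (C : ℝ) (σ₀ : ℝ → ℝ) (hσ₀meas : Measurable σ₀) (hσ₀ : ∀ x, |σ₀ x| ≤ C)
    (v : ℝ × ℝ → ℝ) (hvmeas : Measurable v) (hv : ∀ x t : ℝ, 0 ≤ t → |v (x, t)| ≤ C)
    (hweak2 : ∀ φ : ℝ × ℝ → ℝ, ContDiff ℝ 1 φ → HasCompactSupport φ →
      (∫ t in Set.Ioi (0 : ℝ), ∫ x : ℝ, deriv (fun s => φ (x, s)) t * v (x, t))
        + ∫ x : ℝ, φ (x, 0) * σ₀ x = 0) :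
    ∀ᵐ p : ℝ × ℝ ∂((volume : Measure ℝ).prod (volume.restrict (Ioi (0:ℝ)))), v p = σ₀ p.1 := by
  rw [← aux_restrict]
  have hS : MeasurableSet {p : ℝ × ℝ | 0 < p.2} := measurableSet_lt measurable_const measurable_snd
  rw [ae_restrict_iff' hS]
  have hw : Measurable (fun p : ℝ × ℝ => v p - σ₀ p.1) := by fun_prop
  have hwb : ∀ p ∈ {p : ℝ × ℝ | 0 < p.2}, |v p - σ₀ p.1| ≤ C + C := fun p hp =>
    (abs_sub _ _).trans (add_le_add (hv p.1 p.2 (le_of_lt hp)) (hσ₀ _))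
  have hC : 0 ≤ C := (abs_nonneg _).trans (hσ₀ 0)
  have key := ae_eq_zero_of_integral_contDiff_smul_eq_zero (μ := (volume : Measure (ℝ × ℝ)))
    (f := {p : ℝ × ℝ | 0 < p.2}.indicator (fun p : ℝ × ℝ => v p - σ₀ p.1)) ?_ ?_
  · filter_upwards [key] with p hp hp0
    rw [indicator_of_mem (by exact hp0)] at hp
    linarith
  · rw [locallyIntegrable_iff]
    intro K hK
    apply Measure.integrableOn_of_bounded (M := C + C) hK.measure_lt_top.ne (hw.indicator hS).aestronglyMeasurable
    apply Eventually.of_forall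
    intro p
    by_cases hp : p ∈ {p : ℝ × ℝ | 0 < p.2}
    · rw [indicator_of_mem hp]; exact hwb p hp
    · rw [indicator_of_notMem hp]; simp; linarith
  · intro φ hφ hs
    have hφc := hφ.continuous
    have hφ1 : ContDiff ℝ 1 φ := hφ.of_le (by exact_mod_cast le_top)
    have hint : Integrable φ := hφc.integrable_of_hasCompactSupport hs
    have hint2 : Integrable φ ((volume : Measure ℝ).prod (volume.restrict (Ioi (0:ℝ)))) := by
      rw [← aux_restrict]; exact hint.restrict
    have hI1 : Integrable (fun p : ℝ × ℝ => φ p * v p) ((volume : Measure ℝ).prod (volume.restrict (Ioi (0:ℝ)))) := by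
      rw [← aux_restrict] at hint2 ⊢
      apply hint2.mul_bdd (c := C) hvmeas.aestronglyMeasurable
      rw [ae_restrict_iff' hS]
      exact Eventually.of_forall fun p hp => hv p.1 p.2 (le_of_lt hp)
    have hI2 : Integrable (fun p : ℝ × ℝ => φ p * σ₀ p.1) ((volume : Measure ℝ).prod (volume.restrict (Ioi (0:ℝ)))) := by
      apply hint2.mul_bdd (c := C) (hσ₀meas.comp measurable_fst).aestronglyMeasurable
      exact Eventually.of_forall fun p => hσ₀ _
    have e1 : ∫ p, φ p • {p : ℝ × ℝ | 0 < p.2}.indicator (fun p : ℝ × ℝ => v p - σ₀ p.1) p =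
        ∫ p, (φ p * v p - φ p * σ₀ p.1) ∂((volume : Measure ℝ).prod (volume.restrict (Ioi (0:ℝ)))) := by
      rw [← aux_restrict, ← integral_indicator hS]
      congr 1; ext p
      by_cases hp : p ∈ {p : ℝ × ℝ | 0 < p.2}
      · simp only [indicator_of_mem hp, smul_eq_mul]; ring
      · simp only [indicator_of_notMem hp]; simp
    rw [e1, integral_sub hI1 hI2, integral_prod_symm _ hI1, integral_prod _ hI2]
    obtain ⟨R, hR, hRs⟩ := aux_supp φ hs
    have hz : ∀ p : ℝ × ℝ, ¬ (|p.1| < R ∧ |p.2| < R) → φ p = 0 := fun p hp => by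
      by_contra h0
      exact hp (hRs p (subset_tsupport φ h0))
    have hw := hweak2 (fun p => Real.smoothTransition (p.2 + 2) * auxPhi φ p) ?_ ?_
    · have h1 : ∀ x, Real.smoothTransition (((x:ℝ), (0:ℝ)).2 + 2) * auxPhi φ (x, 0) = ∫ t in Ioi (0:ℝ), φ (x, t) := by
        intro x
        rw [Real.smoothTransition.one_of_one_le (by norm_num)]
        simp [auxPhi]
      have h2 : ∀ t ∈ Ioi (0:ℝ), ∀ x, deriv (fun s => Real.smoothTransition (((x:ℝ), (s:ℝ)).2 + 2) * auxPhi φ (x, s)) t = -φ (x,t) := by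
        intro t ht x
        rw [← (auxPhi_deriv φ hs hφc x t).deriv]
        apply Filter.EventuallyEq.deriv_eq
        filter_upwards [lt_mem_nhds (show (0:ℝ) < t from ht)] with s hs
        rw [Real.smoothTransition.one_of_one_le (by linarith), one_mul]
      rw [setIntegral_congr_fun (g := fun t => -∫ x, φ (x,t) * v (x,t)) measurableSet_Ioi, integral_neg] at hw
      · simp only [h1] at hw
        have h3 : ∀ x, (∫ t in Ioi (0:ℝ), φ (x, t)) * σ₀ x = ∫ t in Ioi (0:ℝ), φ (x,t) * σ₀ x := 
          fun x => (integral_mul_const _ _).symm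
        simp only [h3] at hw
        linarith
      · intro t ht
        simp only [h2 t ht]
        rw [← integral_neg]
        simp
    · have := auxPhi_contDiff φ hs hφ1
      have h2 : ContDiff ℝ 1 Real.smoothTransition := Real.smoothTransition.contDiff
      have h3 : ContDiff ℝ 1 (fun p : ℝ × ℝ => Real.smoothTransition (p.2 + 2)) := h2.comp (by fun_prop)
      exact h3.mul this
    · apply HasCompactSupport.intro ((isCompact_Icc (a := -R) (b := R)).prod (isCompact_Icc (a := -2) (b := R)))
      intro p hp
      by_cases h : p.2 ≤ -2
      · rw [Real.smoothTransition.zero_of_nonpos (by linarith), zero_mul]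
      · have : auxPhi φ p = 0 := by
          unfold auxPhi
          apply setIntegral_eq_zero_of_forall_eq_zero
          intro s hs
          apply hz
          rintro ⟨ha, hb⟩
          apply hp
          rw [abs_lt] at ha hb
          simp only [mem_Ioi] at hs
          simp at ha hb
          refine ⟨⟨ha.1.le, ha.2.le⟩, ⟨by linarith, by linarith⟩⟩
        rw [this, mul_zero]

lemma aux_cov (f : ℝ → ℝ) (hf : LocallyLipschitz f) (hmono : StrictMono f)
    (hsurj : Function.Surjective f) (f' : ℝ → ℝ) (hd : ∀ᵐ x, HasDerivAt f (f' x) x) (F : ℝ → ℝ) :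
    ∫ y, F y = ∫ x, |f' x| * F (f x) := by
  have h0 : volume {x | ¬ HasDerivAt f (f' x) x} = 0 := hd
  obtain ⟨N, hN, hNm, hN0⟩ := exists_measurable_superset_of_null h0
  have hder : ∀ x ∈ Nᶜ, HasDerivWithinAt f (f' x) Nᶜ x := fun x hx => by
    have : HasDerivAt f (f' x) x := by
      by_contra h
      exact hx (hN h)
    exact this.hasDerivWithinAt
  have h1 := integral_image_eq_integral_abs_deriv_smul hNm.compl hder hmono.injective.injOn F
  have himg : volume (f '' N) = 0 := by
    have hU : N = ⋃ n : ℕ, N ∩ Icc (-(n:ℝ)) n := by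
      ext x
      simp only [mem_iUnion, mem_inter_iff, mem_Icc]
      constructor
      · intro h
        obtain ⟨n, hn⟩ := exists_nat_ge |x|
        exact ⟨n, h, abs_le.1 hn⟩
      · rintro ⟨n, h, _⟩; exact h
    rw [hU, image_iUnion, measure_iUnion_null_iff]
    intro n
    obtain ⟨K, hK⟩ := (hf.locallyLipschitzOn (s := Icc (-(n:ℝ)) n)).exists_lipschitzOnWith_of_compact isCompact_Icc
    have h2 := (hK.mono (inter_subset_right (s := N))).hausdorffMeasure_image_le (d := 1) zero_le_one
    rw [hausdorffMeasure_real, measure_mono_null inter_subset_left hN0, mul_zero] at h2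
    exact le_antisymm h2 zero_le
  have hc : f '' Nᶜ = (f '' N)ᶜ := image_compl_eq ⟨hmono.injective, hsurj⟩
  have e1 : ∫ y in f '' Nᶜ, F y = ∫ y, F y := by
    rw [hc, setIntegral_congr_set (t := univ), setIntegral_univ]
    rw [ae_eq_univ, compl_compl, himg]
  have e2 : ∫ x in Nᶜ, |f' x| • F (f x) = ∫ x, |f' x| • F (f x) := by
    rw [setIntegral_congr_set (t := univ), setIntegral_univ]
    rw [ae_eq_univ, compl_compl, hN0]
  rw [← e1, h1, e2]
  rfl

lemma aux_bdd (γ : ℝ × ℝ → ℝ) (hγ : Continuous γ)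
    (hγmono : ∀ t : ℝ, 0 ≤ t → StrictMono (fun x => γ (x, t)))
    (hγsurj : ∀ t : ℝ, 0 ≤ t → Function.Surjective (fun x => γ (x, t))) (R : ℝ) :
    ∃ A : ℝ, ∀ t ∈ Icc 0 R, ∀ x, |γ (x, t)| < R → |x| ≤ A := by
  apply (isCompact_Icc (a := (0:ℝ)) (b := R)).induction_on
    (p := fun s => ∃ A : ℝ, ∀ t ∈ s, ∀ x, |γ (x, t)| < R → |x| ≤ A)
  · exact ⟨0, by simp⟩
  · rintro s t hst ⟨A, hA⟩
    exact ⟨A, fun u hu => hA u (hst hu)⟩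
  · rintro s t ⟨A, hA⟩ ⟨B, hB⟩
    refine ⟨max A B, ?_⟩
    rintro u (hu | hu) x hx
    · exact (hA u hu x hx).trans (le_max_left _ _)
    · exact (hB u hu x hx).trans (le_max_right _ _)
  · intro t ht
    obtain ⟨a, ha⟩ := hγsurj t ht.1 (R + 1)
    obtain ⟨b, hb⟩ := hγsurj t ht.1 (-R - 1)
    simp only at ha hb
    have h1 : ∀ᶠ s in 𝓝 t, R < γ (a, s) :=
      (show ContinuousAt (fun s => γ (a, s)) t by fun_prop).eventually_const_lt (by simp only []; linarith)
    have h2 : ∀ᶠ s in 𝓝 t, γ (b, s) < -R :=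
      (show ContinuousAt (fun s => γ (b, s)) t by fun_prop).eventually_lt_const (by simp only []; linarith)
    refine ⟨{s | 0 ≤ s ∧ R < γ (a, s) ∧ γ (b, s) < -R}, ?_, max |a| |b|, ?_⟩
    · filter_upwards [self_mem_nhdsWithin, nhdsWithin_le_nhds h1, nhdsWithin_le_nhds h2] with s hs h1 h2
      exact ⟨hs.1, h1, h2⟩
    · rintro s ⟨hs, h1, h2⟩ x hx
      rw [abs_lt] at hx
      have hxa : x < a := (hγmono s hs).lt_iff_lt.1 (show γ (x, s) < γ (a, s) by linarith)
      have hxb : b < x := (hγmono s hs).lt_iff_lt.1 (show γ (b, s) < γ (x, s) by linarith)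
      rw [abs_le]
      have := le_max_left |a| |b|
      have := le_max_right |a| |b|
      have := le_abs_self a
      have := neg_abs_le b
      constructor <;> linarith

lemma aux_d2 (φ : ℝ × ℝ → ℝ) (hφ : ContDiff ℝ 1 φ) (y t : ℝ) :
    deriv (fun s => φ (y, s)) t = fderiv ℝ φ (y, t) (0, 1) := by
  have h := (hφ.differentiable one_ne_zero (y, t)).hasFDerivAt
  exact (h.comp_hasDerivAt t ((hasDerivAt_const t y).prodMk (hasDerivAt_id t))).deriv

lemma aux_d1 (φ : ℝ × ℝ → ℝ) (hφ : ContDiff ℝ 1 φ) (y t : ℝ) :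
    deriv (fun s => φ (s, t)) y = fderiv ℝ φ (y, t) (1, 0) := by
  have h := (hφ.differentiable one_ne_zero (y, t)).hasFDerivAt
  exact (h.comp_hasDerivAt y ((hasDerivAt_id y).prodMk (hasDerivAt_const y t))).deriv

lemma aux_ftc (φ γ : ℝ × ℝ → ℝ) (hφ : ContDiff ℝ 1 φ) (hγ : LocallyLipschitz γ) (x R : ℝ)
    (hR : 0 < R) (hz : ∀ p : ℝ × ℝ, ¬ (|p.1| < R ∧ |p.2| < R) → φ p = 0) :
    ∫ t in Ioi (0:ℝ), deriv (fun s => φ (γ (x, s), s)) t = - φ (γ (x, 0), 0) := by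
  have hl : LocallyLipschitz (fun s => φ (γ (x, s), s)) := by
    have h1 : LocallyLipschitz (fun s : ℝ => (x, s)) := (LipschitzWith.prodMk_left x).locallyLipschitz
    have h2 : LocallyLipschitz (fun s : ℝ => (γ (x, s), s)) :=
      (hγ.comp h1).prodMk LocallyLipschitz.id
    exact hφ.locallyLipschitz.comp h2
  obtain ⟨K, hK⟩ := (hl.locallyLipschitzOn (s := uIcc 0 R)).exists_lipschitzOnWith_of_compact isCompact_uIcc
  have h := hK.absolutelyContinuousOnInterval.integral_deriv_eq_sub
  have hzR : ∀ s, R ≤ s → φ (γ (x, s), s) = 0 := fun s hs => hz _ (fun h => by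
    have := (abs_lt.1 h.2).2
    simp only at this
    linarith)
  rw [hzR R le_rfl, zero_sub, intervalIntegral.integral_of_le hR.le] at h
  rw [← h]
  apply setIntegral_eq_of_subset_of_forall_sdiff_eq_zero measurableSet_Ioi Ioc_subset_Ioi_self
  intro t ht
  have hRt : R < t := by
    by_contra h
    exact ht.2 ⟨ht.1, not_lt.1 h⟩
  have : (fun s => φ (γ (x, s), s)) =ᶠ[𝓝 t] fun _ => 0 := by
    filter_upwards [lt_mem_nhds hRt] with s hs
    exact hzR s hs.le
  rw [this.deriv_eq, deriv_const]

/-- recovery of the scalar solution: given a bounded measurable weak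
solution `(η, v)` of the Temple system `η_t − G(v/η)_x = 0, v_t = 0` with data
`(1, σ₀)`, and the associated weak diffeomorphism `γ` with `γ_x = η`, `γ_t = G(v/η)`
a.e. and `γ(·,0) = id`, the function `σ(y,t) = (v/η)(γ(·,t)⁻¹(y), t)` is a weak
solution of the scalar conservation law `σ_t + g(σ)_x = 0`, `g(s) = s·G(s)`, with
initial data `σ₀`. -/
theorem stmt5 (m M m' M' : ℝ) (hm : 0 < m) (hmM : m ≤ M) (hm' : 0 < m') (hm'M' : m' ≤ M')
    (G : ℝ → ℝ) (hG : ContDiffOn ℝ 2 G (Set.Ioi 0))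
    (hG' : ∀ s ∈ Set.Icc m M, 0 < deriv G s)
    (σ₀ : ℝ → ℝ) (hσ₀meas : Measurable σ₀) (hσ₀ : ∀ x, σ₀ x ∈ Set.Icc m M)
    (η v : ℝ × ℝ → ℝ) (hηmeas : Measurable η) (hvmeas : Measurable v)
    (hηbd : ∀ x t : ℝ, 0 ≤ t → η (x, t) ∈ Set.Icc m' M')
    (hratio : ∀ x t : ℝ, 0 ≤ t → v (x, t) / η (x, t) ∈ Set.Icc m M)
    (hweak1 : ∀ φ : ℝ × ℝ → ℝ, ContDiff ℝ 1 φ → HasCompactSupport φ →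
      (∫ t in Set.Ioi (0 : ℝ), ∫ x : ℝ,
          (deriv (fun s => φ (x, s)) t * η (x, t)
            - deriv (fun y => φ (y, t)) x * G (v (x, t) / η (x, t))))
        + ∫ x : ℝ, φ (x, 0) = 0)
    (hweak2 : ∀ φ : ℝ × ℝ → ℝ, ContDiff ℝ 1 φ → HasCompactSupport φ →
      (∫ t in Set.Ioi (0 : ℝ), ∫ x : ℝ, deriv (fun s => φ (x, s)) t * v (x, t))
        + ∫ x : ℝ, φ (x, 0) * σ₀ x = 0)
    (γ : ℝ × ℝ → ℝ) (hγlip : LocallyLipschitz γ)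
    (hγ0 : ∀ x : ℝ, γ (x, 0) = x)
    (hγmono : ∀ t : ℝ, 0 ≤ t → StrictMono (fun x => γ (x, t)))
    (hγsurj : ∀ t : ℝ, 0 ≤ t → Function.Surjective (fun x => γ (x, t)))
    (hγx : ∀ᵐ p : ℝ × ℝ ∂(volume.restrict {p : ℝ × ℝ | 0 < p.2}),
      HasDerivAt (fun y => γ (y, p.2)) (η p) p.1)
    (hγt : ∀ᵐ p : ℝ × ℝ ∂(volume.restrict {p : ℝ × ℝ | 0 < p.2}),
      HasDerivAt (fun s => γ (p.1, s)) (G (v p / η p)) p.2) :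
    ∀ φ : ℝ × ℝ → ℝ, ContDiff ℝ 1 φ → HasCompactSupport φ →
      (∫ t in Set.Ioi (0 : ℝ), ∫ y : ℝ,
          (deriv (fun s => φ (y, s)) t *
              (v (Function.invFun (fun x => γ (x, t)) y, t) /
                η (Function.invFun (fun x => γ (x, t)) y, t))
            + deriv (fun z => φ (z, t)) y *
              ((v (Function.invFun (fun x => γ (x, t)) y, t) /
                  η (Function.invFun (fun x => γ (x, t)) y, t)) *
                G (v (Function.invFun (fun x => γ (x, t)) y, t) /
                  η (Function.invFun (fun x => γ (x, t)) y, t)))))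
        + ∫ y : ℝ, φ (y, 0) * σ₀ y = 0 := by
  intro φ hφ hs
  obtain ⟨R, hR, hRs⟩ := aux_supp φ hs
  have hz : ∀ p : ℝ × ℝ, ¬ (|p.1| < R ∧ |p.2| < R) → φ p = 0 := fun p hp => by
    by_contra h0
    exact hp (hRs p (subset_tsupport φ h0))
  have hz' : ∀ p : ℝ × ℝ, ¬ (|p.1| < R ∧ |p.2| < R) → fderiv ℝ φ p = 0 := fun p hp => by
    by_contra h0
    exact hp (hRs p (support_fderiv_subset ℝ h0))
  have hγc : Continuous γ := hγlip.continuous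
  have hM : 0 < M := hm.trans_le hmM
  have hM' : 0 < M' := hm'.trans_le hm'M'
  have hvη : ∀ x t : ℝ, 0 ≤ t → v (x, t) / η (x, t) * η (x, t) = v (x, t) := fun x t ht =>
    div_mul_cancel₀ _ (hm'.trans_le (hηbd x t ht).1).ne'
  have hv : ∀ x t : ℝ, 0 ≤ t → |v (x, t)| ≤ max (M * M') M := fun x t ht => by
    rw [← hvη x t ht, abs_of_nonneg]
    · refine le_trans ?_ (le_max_left _ _)
      exact mul_le_mul (hratio x t ht).2 (hηbd x t ht).2 (hm'.le.trans (hηbd x t ht).1) hM.le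
    · exact mul_nonneg (hm.le.trans (hratio x t ht).1) (hm'.le.trans (hηbd x t ht).1)
  have hσb : ∀ x, |σ₀ x| ≤ max (M * M') M := fun x => by
    rw [abs_of_nonneg (hm.le.trans (hσ₀ x).1)]
    exact (hσ₀ x).2.trans (le_max_right _ _)
  have hveq := aux_v_eq _ σ₀ hσ₀meas hσb v hvmeas hv hweak2
  have hS : MeasurableSet {p : ℝ × ℝ | 0 < p.2} := measurableSet_lt measurable_const measurable_snd
  obtain ⟨A, hA⟩ := aux_bdd γ hγc hγmono hγsurj R
  have hGc : ContinuousOn G (Icc m M) := hG.continuousOn.mono (fun s hs => hm.trans_le hs.1)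
  obtain ⟨K, hK⟩ := isCompact_Icc.exists_bound_of_continuousOn hGc
  have hdc : Continuous (fderiv ℝ φ) := hφ.continuous_fderiv one_ne_zero
  obtain ⟨C, hC⟩ := hdc.bounded_above_of_compact_support (hs.fderiv ℝ)
  have hC0 : 0 ≤ C := (norm_nonneg _).trans (hC 0)
  have hK0 : 0 ≤ K := (norm_nonneg _).trans (hK m ⟨le_rfl, hmM⟩)
  let D : ℝ × ℝ → ℝ := fun p => fderiv ℝ φ (γ p, p.2) (0, 1)
    + fderiv ℝ φ (γ p, p.2) (1, 0) * G (v p / η p)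
  -- integrability
  have hDint : Integrable (fun p => D p * v p)
      ((volume : Measure ℝ).prod (volume.restrict (Ioi (0:ℝ)))) := by
    rw [← aux_restrict]
    have hmeas : AEStronglyMeasurable (fun p => D p * v p) (volume.restrict {p : ℝ × ℝ | 0 < p.2}) := by
      have hGi : Measurable ((Icc m M).indicator G) := by
        classical
        rw [← piecewise_eq_indicator]
        exact hGc.measurable_piecewise continuousOn_const measurableSet_Icc
      have h1 : Measurable (fun p : ℝ × ℝ => fderiv ℝ φ (γ p, p.2) (0, 1)) :=
        Continuous.measurable (by fun_prop)
      have h2 : Measurable (fun p : ℝ × ℝ => fderiv ℝ φ (γ p, p.2) (1, 0)) :=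
        Continuous.measurable (by fun_prop)
      have h3 : Measurable (fun p => (fderiv ℝ φ (γ p, p.2) (0, 1)
          + fderiv ℝ φ (γ p, p.2) (1, 0) * (Icc m M).indicator G (v p / η p)) * v p) :=
        (h1.add (h2.mul (hGi.comp (hvmeas.div hηmeas)))).mul hvmeas
      refine h3.aestronglyMeasurable.congr ?_
      rw [Filter.EventuallyEq, ae_restrict_iff' hS]
      refine Eventually.of_forall fun p hp => ?_
      simp only [D]
      rw [indicator_of_mem (hratio p.1 p.2 (le_of_lt hp))]
    have hion : IntegrableOn (fun p => D p * v p) (Icc (-A) A ×ˢ Icc (-R) R)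
        (volume.restrict {p : ℝ × ℝ | 0 < p.2}) := by
      apply Measure.integrableOn_of_bounded (M := (C + C * K) * max (M * M') M) _ hmeas
      · apply ae_restrict_of_ae
        rw [ae_restrict_iff' hS]
        refine Eventually.of_forall fun p hp => ?_
        have hp0 : 0 ≤ p.2 := le_of_lt hp
        have n1 : ‖((0:ℝ), (1:ℝ))‖ = 1 := by simp [Prod.norm_def]
        have n2 : ‖((1:ℝ), (0:ℝ))‖ = 1 := by simp [Prod.norm_def]
        have b1 : ‖fderiv ℝ φ (γ p, p.2) (0, 1)‖ ≤ C := by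
          have := (fderiv ℝ φ (γ p, p.2)).le_opNorm (0, 1)
          rw [n1, mul_one] at this
          exact this.trans (hC _)
        have b2 : ‖fderiv ℝ φ (γ p, p.2) (1, 0)‖ ≤ C := by
          have := (fderiv ℝ φ (γ p, p.2)).le_opNorm (1, 0)
          rw [n2, mul_one] at this
          exact this.trans (hC _)
        have b3 : ‖G (v p / η p)‖ ≤ K := hK _ (hratio p.1 p.2 hp0)
        rw [norm_mul]
        refine mul_le_mul ?_ (hv p.1 p.2 hp0) (norm_nonneg _) (by positivity)
        refine (norm_add_le _ _).trans (add_le_add b1 ?_)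
        rw [norm_mul]
        exact mul_le_mul b2 b3 (norm_nonneg _) hC0
      · exact ((Measure.restrict_apply_le _ _).trans_lt
          (isCompact_Icc.prod isCompact_Icc).measure_lt_top).ne
    refine hion.integrable_of_ae_notMem_eq_zero ?_
    rw [ae_restrict_iff' hS]
    refine Eventually.of_forall fun p hp hpn => ?_
    have : fderiv ℝ φ (γ p, p.2) = 0 := by
      apply hz'
      rintro ⟨h1, h2⟩
      simp only at h1 h2
      have h3 := hA p.2 ⟨le_of_lt hp, (abs_lt.1 h2).2.le⟩ p.1 h1
      exact hpn ⟨abs_le.1 h3, abs_le.1 h2.le⟩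
    simp [D, this]
  rw [aux_restrict] at hγx hγt
  -- change of variables
  have hγx' : ∀ᵐ t ∂(volume.restrict (Ioi (0:ℝ))), ∀ᵐ x : ℝ,
      HasDerivAt (fun y => γ (y, t)) (η (x, t)) x := by
    have h := (Measure.measurePreserving_swap (μ := volume.restrict (Ioi (0:ℝ)))
      (ν := (volume : Measure ℝ))).quasiMeasurePreserving.ae hγx
    exact Measure.ae_ae_of_ae_prod h
  have e1 : (∫ t in Set.Ioi (0 : ℝ), ∫ y : ℝ,
          (deriv (fun s => φ (y, s)) t *
              (v (Function.invFun (fun x => γ (x, t)) y, t) /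
                η (Function.invFun (fun x => γ (x, t)) y, t))
            + deriv (fun z => φ (z, t)) y *
              ((v (Function.invFun (fun x => γ (x, t)) y, t) /
                  η (Function.invFun (fun x => γ (x, t)) y, t)) *
                G (v (Function.invFun (fun x => γ (x, t)) y, t) /
                  η (Function.invFun (fun x => γ (x, t)) y, t))))) =
      ∫ t in Ioi (0:ℝ), ∫ x, D (x, t) * v (x, t) := by
    apply integral_congr_ae
    filter_upwards [hγx', ae_restrict_mem measurableSet_Ioi] with t ht ht0
    have ht0' : 0 ≤ t := le_of_lt ht0
    have hlip : LocallyLipschitz (fun x => γ (x, t)) :=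
      hγlip.comp (LipschitzWith.prodMk_right t).locallyLipschitz
    rw [aux_cov (fun x => γ (x, t)) hlip (hγmono t ht0') (hγsurj t ht0') (fun x => η (x, t)) ht]
    congr 1
    ext x
    have hinv : Function.invFun (fun x => γ (x, t)) (γ (x, t)) = x :=
      Function.leftInverse_invFun (hγmono t ht0').injective x
    simp only [hinv, D, aux_d1 φ hφ, aux_d2 φ hφ]
    rw [abs_of_nonneg (hm'.le.trans (hηbd x t ht0').1)]
    have h5 := hvη x t ht0'
    generalize v (x, t) / η (x, t) = r at h5 ⊢
    rw [← h5]
    ring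
  rw [e1, ← integral_prod_symm (fun p => D p * v p) hDint, integral_prod _ hDint, 
    ← sub_neg_eq_add, sub_eq_zero, ← integral_neg]
  apply integral_congr_ae
  filter_upwards [Measure.ae_ae_of_ae_prod hγt, Measure.ae_ae_of_ae_prod hveq] with x hx1 hx2
  have e2 : ∫ t in Ioi (0:ℝ), D (x, t) * v (x, t) =
      ∫ t in Ioi (0:ℝ), deriv (fun s => φ (γ (x, s), s)) t * σ₀ x := by
    apply integral_congr_ae
    filter_upwards [hx1, hx2] with t h1 h2
    rw [h2]
    congr 1
    have h := (hφ.differentiable one_ne_zero (γ (x, t), t)).hasFDerivAt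
    have h3 := (HasFDerivAt.comp_hasDerivAt (f := fun s => (γ (x, s), s)) t h (h1.prodMk (hasDerivAt_id t))).deriv
    have h4 : ((G (v (x, t) / η (x, t)), 1) : ℝ × ℝ) = (0, 1) + G (v (x, t) / η (x, t)) • (1, 0) := by
      ext <;> simp
    rw [h4, map_add, map_smul, smul_eq_mul, mul_comm] at h3
    exact h3.symm
  rw [e2, integral_mul_const, aux_ftc φ γ hφ hγlip x R hR hz, hγ0]
  ring
end

section
/- Under the hypotheses of the preceding setup (bounded measurable weak solution (η, v) of the Temple system with 0 < m' ≤ η ≤ M', m ≤ v/η ≤ M, associated bi-Lipschitz weak diffeomorphism γ with ∂_x γ = η and ∂_t γ = G(v/η) a.e., and σ(y,t) = (v/η)(γ(·,t)⁻¹(y), t)), let E₁ : ℝ → ℝ be a convex continuously differentiable entropy and Q₁ : ℝ → ℝ satisfy Q₁'(s) = E₁'(s)·g'(s) where g(s) = s·G(s). Suppose (η, v) satisfies the system entropy inequality: for every nonnegative test function ψ, ∫₀^∞ ∫_ℝ (∂_t ψ·η·E₁(v/η) + ∂_x ψ·(Q₁(v/η) − G(v/η)·E₁(v/η))) dx dt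 + ∫_ℝ ψ(x,0)·E₁(σ₀(x)) dx ≥ 0. Then σ satisfies the scalar entropy inequality: for every nonnegative test function ψ, ∫₀^∞ ∫_ℝ (∂_t ψ(y,t)·E₁(σ(y,t)) + ∂_x ψ(y,t)·Q₁(σ(y,t))) dy dt + ∫_ℝ ψ(y,0)·E₁(σ₀(y)) dy ≥ 0. -/
open MeasureTheory

lemma aux_lip (Φ : ℝ × ℝ → ℝ) (h : LocallyLipschitz Φ) (hc : HasCompactSupport Φ) :
    ∃ K, LipschitzWith K Φ := by
  obtain ⟨R, hR⟩ := hc.isCompact.isBounded.subset_closedBall (0 : ℝ × ℝ)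
  obtain ⟨C, hC⟩ := hc.exists_bound_of_continuous h.continuous
  obtain ⟨K, hK⟩ := (h.locallyLipschitzOn (s := Metric.closedBall (0 : ℝ × ℝ) (R + 1))).exists_lipschitzOnWith_of_compact
    (isCompact_closedBall _ _)
  have hC0 : 0 ≤ C := (norm_nonneg _).trans (hC 0)
  have hz : ∀ p : ℝ × ℝ, R < ‖p‖ → Φ p = 0 := by
    intro p hp
    by_contra hne
    have := hR (subset_tsupport _ hne)
    simp at this
    linarith
  have key : ∀ p q : ℝ × ℝ, ‖p‖ ≤ R → dist (Φ p) (Φ q) ≤ max (K : ℝ) C * dist p q := by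
    intro p q hp
    by_cases hq : ‖q‖ ≤ R + 1
    · refine (hK.dist_le_mul p (by simp; linarith) q (by simpa using hq)).trans ?_
      gcongr
      exact le_max_left _ _
    · push Not at hq
      rw [hz q (by linarith), dist_zero_right]
      have h1 : 1 ≤ dist p q := by
        have := norm_sub_norm_le q p
        rw [dist_eq_norm_sub']
        linarith
      calc ‖Φ p‖ ≤ C := hC p
        _ ≤ max (K : ℝ) C := le_max_right _ _
        _ ≤ max (K : ℝ) C * dist p q := le_mul_of_one_le_right (hC0.trans (le_max_right _ _)) h1
  refine ⟨⟨max (K : ℝ) C, hC0.trans (le_max_right _ _)⟩, LipschitzWith.of_dist_le_mul fun p q => ?_⟩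
  change dist (Φ p) (Φ q) ≤ max (K : ℝ) C * dist p q
  by_cases hp : ‖p‖ ≤ R
  · exact key p q hp
  · by_cases hq : ‖q‖ ≤ R
    · rw [dist_comm, dist_comm p]; exact key q p hq
    · push Not at hp hq
      rw [hz p hp, hz q hq, dist_self]
      exact mul_nonneg (hC0.trans (le_max_right _ _)) dist_nonneg

lemma aux_null (f : ℝ → ℝ) (h : LocallyLipschitz f) (N : Set ℝ) (hN : volume N = 0) :
    volume (f '' N) = 0 := by
  have : f '' N ⊆ ⋃ n : ℕ, f '' (N ∩ Metric.closedBall 0 n) := by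
    rintro _ ⟨x, hx, rfl⟩
    obtain ⟨n, hn⟩ := exists_nat_ge ‖x‖
    exact Set.mem_iUnion.2 ⟨n, x, ⟨hx, by simpa using hn⟩, rfl⟩
  refine measure_mono_null this (measure_iUnion_null fun n => ?_)
  obtain ⟨K, hK⟩ := (h.locallyLipschitzOn (s := Metric.closedBall (0 : ℝ) n)).exists_lipschitzOnWith_of_compact
    (isCompact_closedBall _ _)
  have h2 := (hK.mono (Set.inter_subset_right (s := N))).hausdorffMeasure_image_le (d := 1) zero_le_one
  rw [hausdorffMeasure_real, measure_mono_null Set.inter_subset_left hN, mul_zero] at h2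
  exact le_antisymm h2 bot_le

lemma aux_cov_s6 (f : ℝ → ℝ) (h : LocallyLipschitz f) (hm : StrictMono f) (hs : Function.Surjective f)
    (e : ℝ → ℝ) (he : ∀ x, 0 ≤ e x) (hd : ∀ᵐ x : ℝ, HasDerivAt f (e x) x) (k : ℝ → ℝ) :
    ∫ y, k (Function.invFun f y) = ∫ x, e x * k x := by
  set T := toMeasurable volume {x | ¬ HasDerivAt f (e x) x} with hT
  have hT0 : volume T = 0 := by rw [hT, measure_toMeasurable]; exact hd
  have hTm : MeasurableSet T := measurableSet_toMeasurable _ _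
  have hder : ∀ x ∈ Tᶜ, HasDerivWithinAt f (e x) Tᶜ x := by
    intro x hx
    have : ¬ ¬ HasDerivAt f (e x) x := fun hh => hx (subset_toMeasurable _ _ hh)
    exact (not_not.1 this).hasDerivWithinAt
  have := integral_image_eq_integral_abs_deriv_smul hTm.compl hder hm.injective.injOn
    (fun y => k (Function.invFun f y))
  have hu : ∀ (S : Set ℝ), volume Sᶜ = 0 → volume.restrict S = volume := fun S hS =>
    Measure.restrict_eq_self_of_ae_mem (by rw [ae_iff]; exact hS)
  rw [hu, hu] at this
  · rw [this]
    refine integral_congr_ae (Filter.Eventually.of_forall fun x => ?_)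
    simp only [smul_eq_mul, abs_of_nonneg (he x), Function.leftInverse_invFun hm.injective x]
  · simpa using hT0
  · rw [← Set.image_compl_eq ⟨hm.injective, hs⟩, compl_compl]
    exact aux_null f h T hT0

lemma aux_cpt (γ : ℝ × ℝ → ℝ) (hc : Continuous γ) (hm : ∀ t, StrictMono fun x => γ (x, t))
    (hs : ∀ t, Function.Surjective fun x => γ (x, t)) (R : ℝ) (S : Set ℝ) (hS : IsCompact S) :
    ∃ L, ∀ t ∈ S, ∀ x, |γ (x, t)| ≤ R → |x| ≤ L := by
  refine hS.induction_on (p := fun S => ∃ L, ∀ t ∈ S, ∀ x, |γ (x, t)| ≤ R → |x| ≤ L) ?_ ?_ ?_ ?_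
  · exact ⟨0, by simp⟩
  · intro s t hst ht
    obtain ⟨L, hL⟩ := ht
    exact ⟨L, fun a ha => hL a (hst ha)⟩
  · intro s t h1 h2
    obtain ⟨L, hL⟩ := h1
    obtain ⟨L', hL'⟩ := h2
    refine ⟨max L L', ?_⟩
    rintro a (ha | ha) x hx
    · exact (hL a ha x hx).trans (le_max_left _ _)
    · exact (hL' a ha x hx).trans (le_max_right _ _)
  · intro t ht
    obtain ⟨a, ha⟩ := hs t (-R - 1)
    obtain ⟨b, hb⟩ := hs t (R + 1)
    have e1 : ∀ᶠ s in nhds t, γ (a, s) < -R :=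
      (by fun_prop : Continuous fun s => γ (a, s)).continuousAt.eventually_lt_const
        (by simp only at ha ⊢; rw [ha]; linarith)
    have e2 : ∀ᶠ s in nhds t, R < γ (b, s) :=
      (by fun_prop : Continuous fun s => γ (b, s)).continuousAt.eventually_const_lt
        (by simp only at hb ⊢; rw [hb]; linarith)
    refine ⟨{s | γ (a, s) < -R ∧ R < γ (b, s)}, mem_nhdsWithin_of_mem_nhds (e1.and e2),
      max |a| |b|, ?_⟩
    rintro s ⟨h1, h2⟩ x hx
    rw [abs_le] at hx
    have hax : a < x := (hm s).lt_iff_lt.1 (show γ (a, s) < γ (x, s) by linarith)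
    have hxb : x < b := (hm s).lt_iff_lt.1 (show γ (x, s) < γ (b, s) by linarith)
    exact abs_le_max_abs_abs hax.le hxb.le

open scoped Convolution in
lemma aux_fd (ρ : ContDiffBump (0 : ℝ × ℝ)) (Φ : ℝ × ℝ → ℝ) (K : NNReal) (hΦ : LipschitzWith K Φ)
    (p : ℝ × ℝ) :
    HasFDerivAt (ρ.normed volume ⋆[ContinuousLinearMap.lsmul ℝ ℝ, volume] Φ)
      ((ρ.normed volume ⋆[ContinuousLinearMap.lsmul ℝ ℝ, volume] (fderiv ℝ Φ)) p) p := by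
  have hcont := hΦ.continuous
  have hρc : Continuous (ρ.normed (volume : Measure (ℝ × ℝ))) := ρ.continuous_normed
  have hρs : HasCompactSupport (ρ.normed (volume : Measure (ℝ × ℝ))) := ρ.hasCompactSupport_normed
  have hd : ∀ᵐ z : ℝ × ℝ, DifferentiableAt ℝ Φ (p - z) :=
    (quasiMeasurePreserving_sub_left (volume : Measure (ℝ × ℝ)) p).ae hΦ.ae_differentiableAt
  refine (hasFDerivAt_integral_of_dominated_loc_of_lip (μ := (volume : Measure (ℝ × ℝ)))
    (F := fun x z => ρ.normed volume z • Φ (x - z))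
    (F' := fun z => ρ.normed volume z • fderiv ℝ Φ (p - z))
    (bound := fun z => ρ.normed volume z * K) (s := Set.univ) (x₀ := p) Filter.univ_mem ?_ ?_ ?_ ?_ ?_ ?_).2
  · exact Filter.Eventually.of_forall fun x => Continuous.aestronglyMeasurable (by fun_prop)
  · exact Continuous.integrable_of_hasCompactSupport (by fun_prop) hρs.smul_right
  · exact (hρc.measurable.smul ((measurable_fderiv ℝ Φ).comp (measurable_const.sub measurable_id))).aestronglyMeasurable
  · refine Filter.Eventually.of_forall fun z => LipschitzOnWith.of_dist_le_mul fun x _ y _ => ?_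
    have h0 := ρ.nonneg_normed (μ := volume) z
    have h1 := hΦ.dist_le_mul (x - z) (y - z)
    rw [dist_sub_right] at h1
    rw [dist_smul₀, Real.norm_of_nonneg h0, Real.coe_nnabs, abs_of_nonneg (by positivity), mul_assoc]
    gcongr
  · exact ρ.integrable_normed.mul_const _
  · filter_upwards [hd] with z hz
    have := hz.hasFDerivAt.comp p ((hasFDerivAt_id p).sub_const z)
    exact this.const_smul (ρ.normed volume z)

lemma aux_dx (ψ : ℝ × ℝ → ℝ) (x t : ℝ) (h : DifferentiableAt ℝ ψ (x, t)) :
    deriv (fun y => ψ (y, t)) x = fderiv ℝ ψ (x, t) (1, 0) := by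
  have h1 : HasDerivAt (fun y : ℝ => (y, t)) ((1 : ℝ), (0 : ℝ)) x :=
    (hasDerivAt_id x).prodMk (hasDerivAt_const x t)
  exact (h.hasFDerivAt.comp_hasDerivAt x h1).deriv

lemma aux_dt (ψ : ℝ × ℝ → ℝ) (x t : ℝ) (h : DifferentiableAt ℝ ψ (x, t)) :
    deriv (fun s => ψ (x, s)) t = fderiv ℝ ψ (x, t) (0, 1) := by
  have h1 : HasDerivAt (fun y : ℝ => (x, y)) ((0 : ℝ), (1 : ℝ)) t :=
    (hasDerivAt_const t x).prodMk (hasDerivAt_id t)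
  exact (h.hasFDerivAt.comp_hasDerivAt t h1).deriv

open scoped Convolution in
lemma aux_ext (A B : ℝ × ℝ → ℝ) (hA : Measurable A) (hB : Measurable B) (D : ℝ → ℝ)
    (hD : Measurable D) (C : ℝ) (hAC : ∀ p, |A p| ≤ C) (hBC : ∀ p, |B p| ≤ C)
    (hDC : ∀ x, |D x| ≤ C)
    (H : ∀ ψ : ℝ × ℝ → ℝ, ContDiff ℝ 1 ψ → HasCompactSupport ψ → (∀ p, 0 ≤ ψ p) →
      0 ≤ (∫ t in Set.Ioi (0 : ℝ), ∫ x : ℝ,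
            (deriv (fun s => ψ (x, s)) t * A (x, t) + deriv (fun y => ψ (y, t)) x * B (x, t)))
          + ∫ x : ℝ, ψ (x, 0) * D x)
    (Φ : ℝ × ℝ → ℝ) (K : NNReal) (hΦ : LipschitzWith K Φ) (hc : HasCompactSupport Φ)
    (h0 : ∀ p, 0 ≤ Φ p) :
    0 ≤ (∫ t in Set.Ioi (0 : ℝ), ∫ x : ℝ,
          (fderiv ℝ Φ (x, t) (0, 1) * A (x, t) + fderiv ℝ Φ (x, t) (1, 0) * B (x, t)))
        + ∫ x : ℝ, Φ (x, 0) * D x := by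
  have hC0 : 0 ≤ C := (abs_nonneg _).trans (hAC 0)
  obtain ⟨R, hR⟩ := hc.isCompact.isBounded.subset_closedBall (0 : ℝ × ℝ)
  obtain ⟨CΦ, hCΦ⟩ := hc.exists_bound_of_continuous hΦ.continuous
  have hCΦ0 : 0 ≤ CΦ := (norm_nonneg _).trans (hCΦ 0)
  have hz : ∀ p : ℝ × ℝ, R < ‖p‖ → Φ p = 0 := by
    intro p hp
    by_contra hne
    have := hR (subset_tsupport _ hne)
    simp at this
    linarith
  have hz' : ∀ p : ℝ × ℝ, R < ‖p‖ → fderiv ℝ Φ p = 0 := by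
    intro p hp
    by_contra hne
    have := hR (support_fderiv_subset ℝ hne)
    simp at this
    linarith
  have hF : ∀ p, ‖fderiv ℝ Φ p‖ ≤ K := fun p => norm_fderiv_le_of_lipschitz ℝ hΦ
  have hFm : Measurable (fderiv ℝ Φ) := measurable_fderiv ℝ Φ
  -- the mollifiers
  let ρ : ℕ → ContDiffBump (0 : ℝ × ℝ) := fun n =>
    ⟨1 / ((n : ℝ) + 1) / 2, 1 / ((n : ℝ) + 1), by positivity, half_lt_self (by positivity)⟩
  have hρ0 : Filter.Tendsto (fun n => (ρ n).rOut) Filter.atTop (nhds 0) :=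
    tendsto_one_div_add_atTop_nhds_zero_nat
  have hρ1 : ∀ n, (ρ n).rOut ≤ 1 := by
    intro n
    change 1 / ((n : ℝ) + 1) ≤ 1
    rw [div_le_one (by positivity)]
    linarith [n.cast_nonneg (α := ℝ)]
  have hρK : ∀ n, (ρ n).rOut ≤ 2 * (ρ n).rIn := by
    intro n
    change 1 / ((n : ℝ) + 1) ≤ 2 * (1 / ((n : ℝ) + 1) / 2)
    linarith
  let Φn : ℕ → ℝ × ℝ → ℝ := fun n => (ρ n).normed volume ⋆[ContinuousLinearMap.lsmul ℝ ℝ, volume] Φ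
  let Fn : ℕ → ℝ × ℝ → (ℝ × ℝ →L[ℝ] ℝ) := fun n =>
    (ρ n).normed volume ⋆[ContinuousLinearMap.lsmul ℝ ℝ, volume] (fderiv ℝ Φ)
  have hfd : ∀ n p, HasFDerivAt (Φn n) (Fn n p) p := fun n p => aux_fd (ρ n) Φ K hΦ p
  have hsm : ∀ n, ContDiff ℝ 1 (Φn n) := fun n =>
    (ρ n).hasCompactSupport_normed.contDiff_convolution_left (n := 1) _ (ρ n).contDiff_normed
      hΦ.continuous.locallyIntegrable
  have hcs : ∀ n, HasCompactSupport (Φn n) := fun n =>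
    (ρ n).hasCompactSupport_normed.convolution _ hc
  have hnn : ∀ n p, 0 ≤ Φn n p := fun n p =>
    integral_nonneg fun z => mul_nonneg ((ρ n).nonneg_normed z) (h0 _)
  have hΦnb : ∀ n p, ‖Φn n p‖ ≤ CΦ := fun n p => by
    rw [← dist_zero_right]
    exact dist_convolution_le hCΦ0 ((ρ n).support_normed_eq).subset (ρ n).nonneg_normed
      (ρ n).integral_normed hΦ.continuous.aestronglyMeasurable
      (fun x _ => by rw [dist_zero_right]; exact hCΦ x)
  have hFnb : ∀ n p, ‖Fn n p‖ ≤ K := fun n p => by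
    rw [← dist_zero_right]
    exact dist_convolution_le K.2 ((ρ n).support_normed_eq).subset (ρ n).nonneg_normed
      (ρ n).integral_normed hFm.aestronglyMeasurable
      (fun x _ => by rw [dist_zero_right]; exact hF x)
  have hfar : ∀ n (p x : ℝ × ℝ), R + 1 < ‖p‖ → x ∈ Metric.ball p (ρ n).rOut → R < ‖x‖ := by
    intro n p x hp hx
    rw [Metric.mem_ball, dist_eq_norm_sub'] at hx
    have := norm_sub_norm_le p x
    linarith [hρ1 n]
  have hΦnz : ∀ n p, R + 1 < ‖p‖ → Φn n p = 0 := fun n p hp => by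
    rw [← dist_le_zero]
    exact dist_convolution_le le_rfl ((ρ n).support_normed_eq).subset (ρ n).nonneg_normed
      (ρ n).integral_normed hΦ.continuous.aestronglyMeasurable
      (fun x hx => by rw [hz x (hfar n p x hp hx), dist_self])
  have hFnz : ∀ n p, R + 1 < ‖p‖ → Fn n p = 0 := fun n p hp => by
    rw [← dist_le_zero]
    exact dist_convolution_le le_rfl ((ρ n).support_normed_eq).subset (ρ n).nonneg_normed
      (ρ n).integral_normed hFm.aestronglyMeasurable
      (fun x hx => by rw [hz' x (hfar n p x hp hx), dist_self])
  have hFli : LocallyIntegrable (fderiv ℝ Φ) (volume : Measure (ℝ × ℝ)) := by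
    refine (locallyIntegrable_const (K : ℝ)).mono hFm.aestronglyMeasurable
      (Filter.Eventually.of_forall fun p => ?_)
    simpa using hF p
  have hFt : ∀ᵐ p : ℝ × ℝ, Filter.Tendsto (fun n => Fn n p) Filter.atTop (nhds (fderiv ℝ Φ p)) :=
    ContDiffBump.ae_convolution_tendsto_right_of_locallyIntegrable hρ0
      (Filter.Eventually.of_forall hρK) hFli
  have hΦt : ∀ p : ℝ × ℝ, Filter.Tendsto (fun n => Φn n p) Filter.atTop (nhds (Φ p)) := fun p =>
    ContDiffBump.convolution_tendsto_right_of_continuous hρ0 hΦ.continuous p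
  have hFne : ∀ n, Fn n = fderiv ℝ (Φn n) := fun n => funext fun p => (hfd n p).fderiv.symm
  -- integrand
  let μ : Measure (ℝ × ℝ) := (volume : Measure ℝ).prod (volume.restrict (Set.Ioi (0 : ℝ)))
  have hμ : μ = (volume : Measure (ℝ × ℝ)).restrict (Set.univ ×ˢ Set.Ioi (0 : ℝ)) := by
    rw [Measure.volume_eq_prod, ← Measure.prod_restrict, Measure.restrict_univ]
  let J : (ℝ × ℝ → (ℝ × ℝ →L[ℝ] ℝ)) → ℝ × ℝ → ℝ := fun F p => F p (0, 1) * A p + F p (1, 0) * B p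
  let bd : ℝ × ℝ → ℝ := (Metric.closedBall (0 : ℝ × ℝ) (R + 1)).indicator fun _ => 2 * K * C
  have hbd : Integrable bd μ := by
    rw [hμ]
    refine Integrable.restrict ?_
    refine (integrable_indicator_iff Metric.isClosed_closedBall.measurableSet).2 ?_
    exact integrableOn_const (isCompact_closedBall _ _).measure_lt_top.ne
  have hJm : ∀ F : ℝ × ℝ → (ℝ × ℝ →L[ℝ] ℝ), Measurable F → Measurable (J F) := by
    intro F hF
    have h1 : Measurable fun p => F p (0, 1) := (ContinuousLinearMap.measurable_apply _).comp hF
    have h2 : Measurable fun p => F p (1, 0) := (ContinuousLinearMap.measurable_apply _).comp hF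
    exact (h1.mul hA).add (h2.mul hB)
  have hJb : ∀ F : ℝ × ℝ → (ℝ × ℝ →L[ℝ] ℝ), (∀ p, ‖F p‖ ≤ K) → (∀ p, R + 1 < ‖p‖ → F p = 0) →
      ∀ p, ‖J F p‖ ≤ bd p := by
    intro F hF hF0 p
    by_cases hp : ‖p‖ ≤ R + 1
    · have hm : p ∈ Metric.closedBall (0 : ℝ × ℝ) (R + 1) := by simpa using hp
      simp only [bd, Set.indicator_of_mem hm]
      have e1 : ‖F p (0, 1)‖ ≤ K := by
        have := (F p).le_of_opNorm_le (hF p) (0, 1)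
        simpa using this
      have e2 : ‖F p (1, 0)‖ ≤ K := by
        have := (F p).le_of_opNorm_le (hF p) (1, 0)
        simpa using this
      calc ‖J F p‖ ≤ ‖F p (0, 1) * A p‖ + ‖F p (1, 0) * B p‖ := norm_add_le _ _
        _ ≤ K * C + K * C := by
          rw [norm_mul, norm_mul]
          gcongr
          · exact hAC p
          · exact hBC p
        _ = 2 * K * C := by ring
    · push Not at hp
      simp only [J, hF0 p hp]
      simp only [zero_apply, zero_mul, add_zero, norm_zero, bd]
      exact Set.indicator_nonneg (fun _ _ => by positivity) _
  have hFnm : ∀ n, Measurable (Fn n) := fun n => by rw [hFne]; exact measurable_fderiv ℝ _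
  have hFub : ∀ p : ℝ × ℝ, R + 1 < ‖p‖ → fderiv ℝ Φ p = 0 := fun p hp => hz' p (by linarith)
  have hint : ∀ F : ℝ × ℝ → (ℝ × ℝ →L[ℝ] ℝ), Measurable F → (∀ p, ‖F p‖ ≤ K) →
      (∀ p, R + 1 < ‖p‖ → F p = 0) → Integrable (J F) μ := fun F h1 h2 h3 =>
    hbd.mono' (hJm F h1).aestronglyMeasurable (Filter.Eventually.of_forall (hJb F h2 h3))
  have lim1 : Filter.Tendsto (fun n => ∫ p, J (Fn n) p ∂μ) Filter.atTop
      (nhds (∫ p, J (fderiv ℝ Φ) p ∂μ)) := by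
    refine tendsto_integral_of_dominated_convergence bd
      (fun n => (hJm _ (hFnm n)).aestronglyMeasurable) hbd
      (fun n => Filter.Eventually.of_forall (hJb _ (hFnb n) (hFnz n))) ?_
    rw [hμ]
    filter_upwards [ae_restrict_of_ae hFt] with p hp
    have h1 : ∀ w : ℝ × ℝ, Filter.Tendsto (fun n => Fn n p w) Filter.atTop
        (nhds (fderiv ℝ Φ p w)) := fun w =>
      ((ContinuousLinearMap.apply ℝ ℝ w).continuous.tendsto _).comp hp
    exact ((h1 _).mul_const _).add ((h1 _).mul_const _)
  have lim2 : Filter.Tendsto (fun n => ∫ x : ℝ, Φn n (x, 0) * D x) Filter.atTop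
      (nhds (∫ x : ℝ, Φ (x, 0) * D x)) := by
    refine tendsto_integral_of_dominated_convergence
      ((Metric.closedBall (0 : ℝ) (R + 1)).indicator fun _ => CΦ * C) (fun n => ?_) ?_ (fun n => ?_) ?_
    · have : Continuous fun x : ℝ => Φn n (x, 0) := (hsm n).continuous.comp (by fun_prop)
      exact (this.measurable.mul hD).aestronglyMeasurable
    · refine (integrable_indicator_iff Metric.isClosed_closedBall.measurableSet).2 ?_
      exact integrableOn_const (isCompact_closedBall _ _).measure_lt_top.ne
    · refine Filter.Eventually.of_forall fun x => ?_
      by_cases hp : ‖x‖ ≤ R + 1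
      · have hm : x ∈ Metric.closedBall (0 : ℝ) (R + 1) := by simpa using hp
        rw [Set.indicator_of_mem hm, norm_mul]
        exact mul_le_mul (hΦnb n _) (hDC x) (norm_nonneg _) hCΦ0
      · push Not at hp
        rw [hΦnz n (x, 0) (by simpa using hp), zero_mul, norm_zero]
        exact Set.indicator_nonneg (fun _ _ => by positivity) _
    · exact Filter.Eventually.of_forall fun x => (hΦt _).mul_const _
  have hfin : 0 ≤ (∫ p, J (fderiv ℝ Φ) p ∂μ) + ∫ x : ℝ, Φ (x, 0) * D x := by
    refine ge_of_tendsto' (lim1.add lim2) fun n => ?_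
    have := H (Φn n) (hsm n) (hcs n) (hnn n)
    rw [integral_prod_symm _ (hint _ (hFnm n) (hFnb n) (hFnz n))]
    have e1 : ∀ x t, deriv (fun s => Φn n (x, s)) t = Fn n (x, t) (0, 1) := fun x t => by
      rw [aux_dt _ _ _ (hfd n _).differentiableAt, hFne]
    have e2 : ∀ x t, deriv (fun y => Φn n (y, t)) x = Fn n (x, t) (1, 0) := fun x t => by
      rw [aux_dx _ _ _ (hfd n _).differentiableAt, hFne]
    simp only [e1, e2] at this
    exact this
  rwa [integral_prod_symm _ (hint _ hFm hF hFub)] at hfin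


/-- admissibility is preserved under the Lagrangian transformation:
in the setup of the recovery theorem, if `(η, v)` satisfies the entropy inequality
for the convex extension `E₂(η,v) = η·E₁(v/η)`, `Q₂(η,v) = Q₁(v/η) − G(v/η)·E₁(v/η)`
of the Temple system, then `σ = (v/η) ∘ γ(·,t)⁻¹` satisfies the scalar entropy
inequality for the convex extension `(E₁, Q₁)` (with `Q₁' = E₁'·g'`, `g(s) = s·G(s)`)
of the scalar law `σ_t + g(σ)_x = 0`. -/
theorem stmt6 (m M m' M' : ℝ) (hm : 0 < m) (hmM : m ≤ M) (hm' : 0 < m') (hm'M' : m' ≤ M')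
    (G : ℝ → ℝ) (hG : ContDiffOn ℝ 2 G (Set.Ioi 0))
    (hG' : ∀ s ∈ Set.Icc m M, 0 < deriv G s)
    (σ₀ : ℝ → ℝ) (hσ₀meas : Measurable σ₀) (hσ₀ : ∀ x, σ₀ x ∈ Set.Icc m M)
    (η v : ℝ × ℝ → ℝ) (hηmeas : Measurable η) (hvmeas : Measurable v)
    (hηbd : ∀ x t : ℝ, 0 ≤ t → η (x, t) ∈ Set.Icc m' M')
    (hratio : ∀ x t : ℝ, 0 ≤ t → v (x, t) / η (x, t) ∈ Set.Icc m M)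
    (hweak1 : ∀ φ : ℝ × ℝ → ℝ, ContDiff ℝ 1 φ → HasCompactSupport φ →
      (∫ t in Set.Ioi (0 : ℝ), ∫ x : ℝ,
          (deriv (fun s => φ (x, s)) t * η (x, t)
            - deriv (fun y => φ (y, t)) x * G (v (x, t) / η (x, t))))
        + ∫ x : ℝ, φ (x, 0) = 0)
    (hweak2 : ∀ φ : ℝ × ℝ → ℝ, ContDiff ℝ 1 φ → HasCompactSupport φ →
      (∫ t in Set.Ioi (0 : ℝ), ∫ x : ℝ, deriv (fun s => φ (x, s)) t * v (x, t))
        + ∫ x : ℝ, φ (x, 0) * σ₀ x = 0)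
    (γ : ℝ × ℝ → ℝ) (hγlip : LocallyLipschitz γ)
    (hγ0 : ∀ x : ℝ, γ (x, 0) = x)
    (hγmono : ∀ t : ℝ, 0 ≤ t → StrictMono (fun x => γ (x, t)))
    (hγsurj : ∀ t : ℝ, 0 ≤ t → Function.Surjective (fun x => γ (x, t)))
    (hγx : ∀ᵐ p : ℝ × ℝ ∂(volume.restrict {p : ℝ × ℝ | 0 < p.2}),
      HasDerivAt (fun y => γ (y, p.2)) (η p) p.1)
    (hγt : ∀ᵐ p : ℝ × ℝ ∂(volume.restrict {p : ℝ × ℝ | 0 < p.2}),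
      HasDerivAt (fun s => γ (p.1, s)) (G (v p / η p)) p.2)
    -- the convex extension (E₁, Q₁) of the scalar law with flux g(s) = s·G(s)
    (E₁ Q₁ : ℝ → ℝ) (hE₁ : ContDiff ℝ 1 E₁) (hE₁conv : ConvexOn ℝ Set.univ E₁)
    (hQ₁ : ∀ s : ℝ, HasDerivAt Q₁ (deriv E₁ s * deriv (fun r => r * G r) s) s)
    -- the system entropy inequality for E₂(η,v) = η·E₁(v/η), Q₂ = Q₁(v/η) − G(v/η)·E₁(v/η)
    (hsysent : ∀ ψ : ℝ × ℝ → ℝ, ContDiff ℝ 1 ψ → HasCompactSupport ψ → (∀ p, 0 ≤ ψ p) →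
      0 ≤ (∫ t in Set.Ioi (0 : ℝ), ∫ x : ℝ,
            (deriv (fun s => ψ (x, s)) t * (η (x, t) * E₁ (v (x, t) / η (x, t)))
              + deriv (fun y => ψ (y, t)) x *
                (Q₁ (v (x, t) / η (x, t))
                  - G (v (x, t) / η (x, t)) * E₁ (v (x, t) / η (x, t)))))
          + ∫ x : ℝ, ψ (x, 0) * E₁ (σ₀ x)) :
    -- conclusion: the scalar entropy inequality for σ = (v/η) ∘ γ(·,t)⁻¹
    ∀ ψ : ℝ × ℝ → ℝ, ContDiff ℝ 1 ψ → HasCompactSupport ψ → (∀ p, 0 ≤ ψ p) →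
      0 ≤ (∫ t in Set.Ioi (0 : ℝ), ∫ y : ℝ,
            (deriv (fun s => ψ (y, s)) t *
                E₁ (v (Function.invFun (fun x => γ (x, t)) y, t) /
                    η (Function.invFun (fun x => γ (x, t)) y, t))
              + deriv (fun z => ψ (z, t)) y *
                Q₁ (v (Function.invFun (fun x => γ (x, t)) y, t) /
                    η (Function.invFun (fun x => γ (x, t)) y, t))))
          + ∫ y : ℝ, ψ (y, 0) * E₁ (σ₀ y) := by
  intro ψ hψ hψc hψ0
  have hψd : Differentiable ℝ ψ := hψ.differentiable one_ne_zero
  -- clamped unknowns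
  let w : ℝ × ℝ → ℝ := fun p => max m (min M (v p / η p))
  let h : ℝ × ℝ → ℝ := fun p => max m' (min M' (η p))
  have hw : ∀ x t : ℝ, 0 ≤ t → w (x, t) = v (x, t) / η (x, t) := fun x t ht => by
    have := hratio x t ht
    simp only [w]; rw [min_eq_right this.2, max_eq_right this.1]
  have hh : ∀ x t : ℝ, 0 ≤ t → h (x, t) = η (x, t) := fun x t ht => by
    have := hηbd x t ht
    simp only [h]; rw [min_eq_right this.2, max_eq_right this.1]
  have hwI : ∀ p, w p ∈ Set.Icc m M := fun p =>
    ⟨le_max_left _ _, max_le hmM (min_le_left _ _)⟩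
  have hhI : ∀ p, h p ∈ Set.Icc m' M' := fun p =>
    ⟨le_max_left _ _, max_le hm'M' (min_le_left _ _)⟩
  have hwm : Measurable w := measurable_const.max (measurable_const.min (hvmeas.div hηmeas))
  have hhm : Measurable h := measurable_const.max (measurable_const.min hηmeas)
  have hEc : Continuous E₁ := hE₁.continuous
  have hQc : Continuous Q₁ := continuous_iff_continuousAt.2 fun s => (hQ₁ s).continuousAt
  have hsub : Set.Icc m M ⊆ Set.Ioi 0 := fun s hs => lt_of_lt_of_le hm hs.1
  have hGc : ContinuousOn G (Set.Icc m M) := hG.continuousOn.mono hsub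
  have hGcl : Continuous fun s : ℝ => G (max m (min M s)) :=
    hGc.comp_continuous (by fun_prop) fun s => ⟨le_max_left _ _, max_le hmM (min_le_left _ _)⟩
  have hGm : Measurable fun p => G (w p) := hGcl.measurable.comp (hvmeas.div hηmeas)
  obtain ⟨CE, hCE⟩ := isCompact_Icc.exists_bound_of_continuousOn (s := Set.Icc m M) hEc.continuousOn
  obtain ⟨CQ, hCQ⟩ := isCompact_Icc.exists_bound_of_continuousOn (s := Set.Icc m M) hQc.continuousOn
  obtain ⟨CG, hCG⟩ := isCompact_Icc.exists_bound_of_continuousOn (s := Set.Icc m M) hGc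
  have hmm : m ∈ Set.Icc m M := ⟨le_rfl, hmM⟩
  have hCE0 : 0 ≤ CE := (norm_nonneg _).trans (hCE m hmm)
  have hCQ0 : 0 ≤ CQ := (norm_nonneg _).trans (hCQ m hmm)
  have hCG0 : 0 ≤ CG := (norm_nonneg _).trans (hCG m hmm)
  have hM'0 : 0 ≤ M' := hm'.le.trans hm'M'
  let A : ℝ × ℝ → ℝ := fun p => h p * E₁ (w p)
  let B : ℝ × ℝ → ℝ := fun p => Q₁ (w p) - G (w p) * E₁ (w p)
  have hAm : Measurable A := hhm.mul (hEc.measurable.comp hwm)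
  have hBm : Measurable B := (hQc.measurable.comp hwm).sub (hGm.mul (hEc.measurable.comp hwm))
  have hDm : Measurable fun x => E₁ (σ₀ x) := hEc.measurable.comp hσ₀meas
  let C : ℝ := M' * CE + (CQ + CG * CE) + CE
  have hP1 : 0 ≤ M' * CE := by positivity
  have hP2 : 0 ≤ CG * CE := by positivity
  have hAC : ∀ p, |A p| ≤ C := fun p => by
    have : |A p| ≤ M' * CE := by
      simp only [A]
      rw [abs_mul, abs_of_nonneg (hm'.le.trans (hhI p).1)]
      exact mul_le_mul (hhI p).2 (hCE _ (hwI p)) (abs_nonneg _) hM'0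
    simp only [C]; linarith
  have hBC : ∀ p, |B p| ≤ C := fun p => by
    have : |B p| ≤ CQ + CG * CE := by
      refine (abs_sub _ _).trans ?_
      rw [abs_mul]
      exact add_le_add (hCQ _ (hwI p))
        (mul_le_mul (hCG _ (hwI p)) (hCE _ (hwI p)) (abs_nonneg _) hCG0)
    simp only [C]; linarith
  have hDC : ∀ x, |E₁ (σ₀ x)| ≤ C := fun x => by
    have : |E₁ (σ₀ x)| ≤ CE := hCE _ (hσ₀ x)
    simp only [C]; linarith
  have H : ∀ ψ : ℝ × ℝ → ℝ, ContDiff ℝ 1 ψ → HasCompactSupport ψ → (∀ p, 0 ≤ ψ p) →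
      0 ≤ (∫ t in Set.Ioi (0 : ℝ), ∫ x : ℝ,
            (deriv (fun s => ψ (x, s)) t * A (x, t) + deriv (fun y => ψ (y, t)) x * B (x, t)))
          + ∫ x : ℝ, ψ (x, 0) * E₁ (σ₀ x) := by
    intro φ h1 h2 h3
    refine (hsysent φ h1 h2 h3).trans_eq ?_
    congr 1
    refine setIntegral_congr_fun measurableSet_Ioi fun t ht => ?_
    have ht0 : (0 : ℝ) ≤ t := le_of_lt ht
    simp only [A, B, hw _ t ht0, hh _ t ht0]
  -- the Lipschitz test function
  let γ' : ℝ × ℝ → ℝ := fun p => γ (p.1, |p.2|)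
  have habs : LocallyLipschitz fun p : ℝ × ℝ => (p.1, |p.2|) :=
    (LipschitzWith.prod_fst.prodMk (lipschitzWith_one_norm.comp LipschitzWith.prod_snd)).locallyLipschitz
  have hγ'lip : LocallyLipschitz γ' := hγlip.comp habs
  let Φ : ℝ × ℝ → ℝ := fun p => ψ (γ' p, p.2)
  have hΦlip : LocallyLipschitz Φ :=
    hψ.locallyLipschitz.comp (hγ'lip.prodMk LipschitzWith.prod_snd.locallyLipschitz)
  have hΦc : HasCompactSupport Φ := by
    obtain ⟨R, hR⟩ := hψc.isCompact.isBounded.subset_closedBall (0 : ℝ × ℝ)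
    obtain ⟨L, hL⟩ := aux_cpt γ' hγ'lip.continuous (fun t => hγmono |t| (abs_nonneg t))
      (fun t => hγsurj |t| (abs_nonneg t)) R (Metric.closedBall 0 R) (isCompact_closedBall _ _)
    refine HasCompactSupport.intro ((isCompact_closedBall (0 : ℝ) L).prod
      (isCompact_closedBall (0 : ℝ) R)) fun p hp => ?_
    by_contra hne
    have h1 := hR (subset_tsupport ψ hne)
    rw [mem_closedBall_zero_iff, Prod.norm_def, max_le_iff] at h1
    refine hp ⟨?_, ?_⟩
    · rw [mem_closedBall_zero_iff]
      exact hL p.2 (by rw [mem_closedBall_zero_iff]; exact h1.2) p.1 h1.1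
    · rw [mem_closedBall_zero_iff]; exact h1.2
  obtain ⟨K, hK⟩ := aux_lip Φ hΦlip hΦc
  have key := aux_ext A B hAm hBm (fun x => E₁ (σ₀ x)) hDm C hAC hBC hDC H Φ K hK hΦc
    (fun p => hψ0 _)
  refine key.trans_eq ?_
  congr 1
  swap
  · simp only [Φ, γ', abs_zero, hγ0]
  -- a.e. statements
  have hset : (volume : Measure (ℝ × ℝ)).restrict {p : ℝ × ℝ | 0 < p.2}
      = (volume : Measure ℝ).prod (volume.restrict (Set.Ioi (0 : ℝ))) := by
    have : {p : ℝ × ℝ | 0 < p.2} = Set.univ ×ˢ Set.Ioi (0 : ℝ) := by ext p; simp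
    rw [this, Measure.volume_eq_prod, ← Measure.prod_restrict, Measure.restrict_univ]
  have hall : ∀ᵐ p ∂((volume : Measure ℝ).prod (volume.restrict (Set.Ioi (0 : ℝ)))),
      DifferentiableAt ℝ Φ p ∧ HasDerivAt (fun y => γ (y, p.2)) (η p) p.1 ∧
      HasDerivAt (fun s => γ (p.1, s)) (G (v p / η p)) p.2 := by
    rw [← hset]
    filter_upwards [ae_restrict_of_ae hK.ae_differentiableAt, hγx, hγt] with p h1 h2 h3
    exact ⟨h1, h2, h3⟩
  have hall2 : ∀ᵐ t ∂(volume.restrict (Set.Ioi (0 : ℝ))), ∀ᵐ x : ℝ,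
      DifferentiableAt ℝ Φ (x, t) ∧ HasDerivAt (fun y => γ (y, t)) (η (x, t)) x ∧
      HasDerivAt (fun s => γ (x, s)) (G (v (x, t) / η (x, t))) t := by
    rw [← Measure.prod_swap] at hall
    exact Measure.ae_ae_of_ae_prod (ae_of_ae_map measurable_swap.aemeasurable hall)
  refine integral_congr_ae ?_
  filter_upwards [hall2, ae_restrict_mem measurableSet_Ioi] with t ht ht0
  have ht0' : (0 : ℝ) < t := ht0
  have htn : (0 : ℝ) ≤ t := ht0'.le
  let k : ℝ → ℝ := fun x => fderiv ℝ ψ (γ (x, t), t) (0, 1) * E₁ (v (x, t) / η (x, t))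
    + fderiv ℝ ψ (γ (x, t), t) (1, 0) * Q₁ (v (x, t) / η (x, t))
  have hcov := aux_cov_s6 (fun x => γ (x, t)) (hγlip.comp (LocallyLipschitz.prodMk_right t))
    (hγmono t htn) (hγsurj t htn) (fun x => η (x, t)) (fun x => hm'.le.trans (hηbd x t htn).1)
    (ht.mono fun x hx => hx.2.1) k
  have hR : ∀ y, γ (Function.invFun (fun x => γ (x, t)) y, t) = y := fun y =>
    Function.rightInverse_invFun (hγsurj t htn) y
  simp only [k, hR] at hcov
  simp only [aux_dt ψ _ _ (hψd _), aux_dx ψ _ _ (hψd _)]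
  rw [hcov]
  refine integral_congr_ae ?_
  filter_upwards [ht] with x hx
  obtain ⟨h1, h2, h3⟩ := hx
  have hγ' : γ' (x, t) = γ (x, t) := by simp only [γ', abs_of_pos ht0']
  have hψf : HasFDerivAt ψ (fderiv ℝ ψ (γ (x, t), t)) (γ (x, t), t) := (hψd _).hasFDerivAt
  have ex : fderiv ℝ Φ (x, t) (1, 0) = fderiv ℝ ψ (γ (x, t), t) (η (x, t), 0) := by
    rw [← aux_dx Φ x t h1]
    have h4 := hψf.comp_hasDerivAt x (h2.prodMk (hasDerivAt_const x t))
    simp only [Φ, γ', abs_of_pos ht0']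
    exact h4.deriv
  have et : fderiv ℝ Φ (x, t) (0, 1)
      = fderiv ℝ ψ (γ (x, t), t) (G (v (x, t) / η (x, t)), 1) := by
    rw [← aux_dt Φ x t h1]
    have h4 := HasFDerivAt.comp_hasDerivAt (f := fun s : ℝ => (γ (x, s), s)) t hψf
      (h3.prodMk (hasDerivAt_id t))
    refine (h4.congr_of_eventuallyEq ?_).deriv
    filter_upwards [lt_mem_nhds ht0'] with s hs
    simp only [Φ, γ', abs_of_pos hs, Function.comp, id]
  have hlin : ∀ a b : ℝ, fderiv ℝ ψ (γ (x, t), t) (a, b)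
      = a * fderiv ℝ ψ (γ (x, t), t) (1, 0) + b * fderiv ℝ ψ (γ (x, t), t) (0, 1) := by
    intro a b
    have : ((a, b) : ℝ × ℝ) = a • ((1 : ℝ), (0 : ℝ)) + b • ((0 : ℝ), (1 : ℝ)) := by simp
    rw [this, map_add, map_smul, map_smul, smul_eq_mul, smul_eq_mul]
  simp only [A, B]
  rw [ex, et, hlin (η (x, t)) 0, hlin (G _) 1, hw x t htn, hh x t htn]
  ring
end

section
/- Let G : (0,∞) → ℝ and S : ℝ → ℝ be twice continuously differentiable, and let Q₁ : ℝ → ℝ satisfy Q₁'(s) = S'(s)·(G(s) + s·G'(s)) for all s. Define, for η > 0 and v ∈ ℝ, E(η, v) = η·S(v/η) and Q(η, v) = Q₁(v/η) − G(v/η)·S(v/η). Then for all η > 0 and v ∈ ℝ: ∂E/∂η = S(v/η) − (v/η)·S'(v/η), ∂Q/∂η = (∂E/∂η)·(v/η²)·G'(v/η), and ∂Q/∂v = −(∂E/∂η)·(1/η)·G'(v/η). Consequently, if (η, v) is a continuously differentiable solution of η_t − G(v/η)_x = 0, v_t = 0 on an open set with η > 0, then ∂_t E(η, v) + ∂_x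 Q(η, v) = 0 on that set. -/
/-- entropy–entropy flux pairs of the Temple system: with
`E(η,v) = η·S(v/η)` and `Q(η,v) = Q₁(v/η) − G(v/η)·S(v/η)`, where
`Q₁'(s) = S'(s)·(G(s) + s·G'(s))`, one has `∂E/∂η = S(v/η) − (v/η)·S'(v/η)`,
`∂Q/∂η = (∂E/∂η)·(v/η²)·G'(v/η)` and `∂Q/∂v = −(∂E/∂η)·(1/η)·G'(v/η)`; consequently
any `C¹` solution `(η, v)` of `η_t − G(v/η)_x = 0, v_t = 0` with `η > 0` on an open
set satisfies `∂_t E(η,v) + ∂_x Q(η,v) = 0` there. -/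
theorem stmt8 (G S Q₁ : ℝ → ℝ) (hG : ContDiff ℝ 2 G) (hS : ContDiff ℝ 2 S)
    (hQ₁ : ∀ s : ℝ, HasDerivAt Q₁ (deriv S s * (G s + s * deriv G s)) s) :
    (∀ η v : ℝ, 0 < η →
      HasDerivAt (fun h => h * S (v / h)) (S (v / η) - v / η * deriv S (v / η)) η ∧
      HasDerivAt (fun h => Q₁ (v / h) - G (v / h) * S (v / h))
        ((S (v / η) - v / η * deriv S (v / η)) * (v / η ^ 2 * deriv G (v / η))) η ∧
      HasDerivAt (fun w => Q₁ (w / η) - G (w / η) * S (w / η))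
        (-((S (v / η) - v / η * deriv S (v / η)) * (1 / η * deriv G (v / η)))) v) ∧
    (∀ (U : Set (ℝ × ℝ)), IsOpen U → ∀ η v : ℝ × ℝ → ℝ,
      ContDiffOn ℝ 1 η U → ContDiffOn ℝ 1 v U →
      (∀ p ∈ U, 0 < η p) →
      (∀ p : ℝ × ℝ, p ∈ U →
        deriv (fun s => η (p.1, s)) p.2
          - deriv (fun y => G (v (y, p.2) / η (y, p.2))) p.1 = 0) →
      (∀ p : ℝ × ℝ, p ∈ U → deriv (fun s => v (p.1, s)) p.2 = 0) →
      ∀ p : ℝ × ℝ, p ∈ U →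
        deriv (fun s => η (p.1, s) * S (v (p.1, s) / η (p.1, s))) p.2
          + deriv (fun y => Q₁ (v (y, p.2) / η (y, p.2))
              - G (v (y, p.2) / η (y, p.2)) * S (v (y, p.2) / η (y, p.2))) p.1 = 0) := by
  have hGd : ∀ s, HasDerivAt G (deriv G s) s := fun s =>
    ((hG.differentiable (by norm_num)) s).hasDerivAt
  have hSd : ∀ s, HasDerivAt S (deriv S s) s := fun s =>
    ((hS.differentiable (by norm_num)) s).hasDerivAt
  have hF : ∀ s, HasDerivAt (fun s => Q₁ s - G s * S s)
      (-((S s - s * deriv S s) * deriv G s)) s := fun s => by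
    have h := (hQ₁ s).sub ((hGd s).mul (hSd s))
    refine h.congr_deriv ?_
    ring
  refine ⟨fun η v hη => ?_, ?_⟩
  · have hne : η ≠ 0 := hη.ne'
    have h1 : HasDerivAt (fun h : ℝ => v / h) (-(v / η ^ 2)) η := by
      have h := (hasDerivAt_const η v).div (hasDerivAt_id η) hne
      refine h.congr_deriv ?_
      simp [neg_div]
    have h2 : HasDerivAt (fun w : ℝ => w / η) (1 / η) v := (hasDerivAt_id v).div_const η
    refine ⟨?_, ?_, ?_⟩
    · have h := (hasDerivAt_id η).mul ((hSd (v / η)).comp η h1)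
      refine h.congr_deriv ?_
      simp only [id, Function.comp]
      field_simp
      ring
    · refine ((hF (v / η)).comp η h1).congr_deriv ?_
      ring
    · refine ((hF (v / η)).comp v h2).congr_deriv ?_
      ring
  · intro U hU η v hη hv hpos h1 h2 p hp
    have hne : η p ≠ 0 := (hpos p hp).ne'
    have dη : DifferentiableAt ℝ η (p.1, p.2) :=
      (hη.differentiableOn (by norm_num)).differentiableAt (hU.mem_nhds hp)
    have dv : DifferentiableAt ℝ v (p.1, p.2) :=
      (hv.differentiableOn (by norm_num)).differentiableAt (hU.mem_nhds hp)
    have ct : DifferentiableAt ℝ (fun s : ℝ => (p.1, s)) p.2 := by fun_prop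
    have cx : DifferentiableAt ℝ (fun y : ℝ => (y, p.2)) p.1 := by fun_prop
    have ηt := (DifferentiableAt.comp p.2 dη ct).hasDerivAt
    have vt := (DifferentiableAt.comp p.2 dv ct).hasDerivAt
    have ηx := DifferentiableAt.comp p.1 dη cx
    have vx := DifferentiableAt.comp p.1 dv cx
    have sx := (vx.div ηx hne).hasDerivAt
    have st := vt.div ηt hne
    have e1 := (ηt.mul ((hSd _).comp p.2 st)).deriv
    have e2 := ((hF _).comp p.1 sx).deriv
    have e3 := ((hGd _).comp p.1 sx).deriv
    have k1 := h1 p hp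
    have k2 := h2 p hp
    simp only [Function.comp_def, Pi.div_def, Pi.mul_def] at e1 e2 e3
    rw [e3] at k1
    rw [e1, e2, k2]
    have k1' := sub_eq_zero.mp k1
    rw [k1']
    have hne' : η (p.1, p.2) ≠ 0 := hne
    field_simp
    ring
end

section
/- Let a : ℤ → ℝ² and c : ℤ → ℝ² be sequences such that for every j ∈ ℤ, each coordinate of c_j lies between the corresponding coordinates of a_{j−1} and a_j (componentwise betweenness). Then, with ‖w‖ = |w₁| + |w₂| the ℓ¹ norm on ℝ², the total variation does not increase: ∑_{j ∈ ℤ} ‖c_j − c_{j−1}‖ ≤ ∑_{j ∈ ℤ} ‖a_j − a_{j−1}‖, where both sums are interpreted as (possibly infinite) sums of nonnegative reals. -/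
theorem between_abs (x y z : ℝ) (h1 : min x z ≤ y) (h2 : y ≤ max x z) :
    |y - x| + |z - y| = |z - x| := by
  rcases le_total x z with hxz | hxz
  · rw [min_eq_left hxz] at h1
    rw [max_eq_right hxz] at h2
    rw [abs_of_nonneg (by linarith), abs_of_nonneg (by linarith), abs_of_nonneg (by linarith)]
    ring
  · rw [min_eq_right hxz] at h1
    rw [max_eq_left hxz] at h2
    rw [abs_of_nonpos (by linarith), abs_of_nonpos (by linarith), abs_of_nonpos (by linarith)]
    ring

/-- total variation does not increase under componentwise averaging:
if each coordinate of `c j` lies between the corresponding coordinates of `a (j−1)`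
and `a j`, then `∑_j ‖c j − c (j−1)‖₁ ≤ ∑_j ‖a j − a (j−1)‖₁` (sums of nonnegative
terms over `ℤ`, possibly infinite). -/
theorem stmt12 (a c : ℤ → ℝ × ℝ)
    (h : ∀ j : ℤ,
      (min (a (j - 1)).1 (a j).1 ≤ (c j).1 ∧ (c j).1 ≤ max (a (j - 1)).1 (a j).1) ∧
      (min (a (j - 1)).2 (a j).2 ≤ (c j).2 ∧ (c j).2 ≤ max (a (j - 1)).2 (a j).2)) :
    (∑' j : ℤ, ENNReal.ofReal (|(c j).1 - (c (j - 1)).1| + |(c j).2 - (c (j - 1)).2|))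
      ≤ ∑' j : ℤ, ENNReal.ofReal (|(a j).1 - (a (j - 1)).1| + |(a j).2 - (a (j - 1)).2|) := by
  let P : ℤ → ENNReal := fun j =>
    ENNReal.ofReal (|(c j).1 - (a (j - 1)).1| + |(c j).2 - (a (j - 1)).2|)
  let Q : ℤ → ENNReal := fun j =>
    ENNReal.ofReal (|(a j).1 - (c j).1| + |(a j).2 - (c j).2|)
  have hshift : ∑' j : ℤ, Q (j - 1) = ∑' j : ℤ, Q j :=
    (Equiv.subRight (1 : ℤ)).tsum_eq Q
  calc _ ≤ ∑' j : ℤ, (P j + Q (j - 1)) := by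
        refine ENNReal.tsum_le_tsum fun j => ?_
        simp only [P, Q]
        rw [← ENNReal.ofReal_add (by positivity) (by positivity)]
        apply ENNReal.ofReal_le_ofReal
        have h1 := abs_sub_le (c j).1 (a (j - 1)).1 (c (j - 1)).1
        have h2 := abs_sub_le (c j).2 (a (j - 1)).2 (c (j - 1)).2
        linarith
    _ = ∑' j : ℤ, (P j + Q j) := by
        rw [ENNReal.tsum_add, ENNReal.tsum_add, hshift]
    _ = _ := by
        refine tsum_congr fun j => ?_
        simp only [P, Q]
        rw [← ENNReal.ofReal_add (by positivity) (by positivity)]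
        congr 1
        obtain ⟨⟨h1, h2⟩, h3, h4⟩ := h j
        have e1 := between_abs _ _ _ h1 h2
        have e2 := between_abs _ _ _ h3 h4
        linarith
end

section
/- Let P : ℝ² → ℝ² be Lipschitz with constant C with respect to the ℓ¹ norm ‖w‖ = |w₁| + |w₂|, let h, k > 0 and V ≥ 0, and let w : ℕ → ℤ → ℝ² satisfy the finite-difference recursion w_jⁿ⁺¹ = w_jⁿ + (k/h)·(P(w_jⁿ) − P(w_{j−1}ⁿ)) for all n ∈ ℕ, j ∈ ℤ. Suppose that for every n, ∑_{j ∈ ℤ} ‖w_jⁿ − w_{j−1}ⁿ‖ ≤ V. Then for all natural numbers r ≤ R, h·∑_{j ∈ ℤ} ‖w_j^R − w_j^r‖ ≤ C·k·(R − r)·V, where the sums are interpreted as (possibly infinite) sums of nonnegative reals. -/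
/-- L¹-in-space continuity in time of the Godunov approximations:
if `P` is `C`-Lipschitz for the ℓ¹ norm, the grid function `w` satisfies the
conservative finite-difference recursion
`w_j^{n+1} = w_j^n + (k/h)·(P(w_j^n) − P(w_{j−1}^n))`, and the total variation of
each time slice is at most `V`, then for all `r ≤ R`,
`h·∑_j ‖w_j^R − w_j^r‖₁ ≤ C·k·(R − r)·V`. -/
theorem stmt13 (P : ℝ × ℝ → ℝ × ℝ) (C : ℝ) (hC : 0 ≤ C)
    (hP : ∀ u w : ℝ × ℝ,
      |(P u).1 - (P w).1| + |(P u).2 - (P w).2| ≤ C * (|u.1 - w.1| + |u.2 - w.2|))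
    (h k V : ℝ) (hh : 0 < h) (hk : 0 < k) (hV : 0 ≤ V)
    (w : ℕ → ℤ → ℝ × ℝ)
    (hrec : ∀ (n : ℕ) (j : ℤ),
      w (n + 1) j = w n j + (k / h) • (P (w n j) - P (w n (j - 1))))
    (hTV : ∀ n : ℕ,
      (∑' j : ℤ, ENNReal.ofReal
          (|(w n j).1 - (w n (j - 1)).1| + |(w n j).2 - (w n (j - 1)).2|))
        ≤ ENNReal.ofReal V) :
    ∀ r R : ℕ, r ≤ R →
      ENNReal.ofReal h *
          (∑' j : ℤ, ENNReal.ofReal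
            (|(w R j).1 - (w r j).1| + |(w R j).2 - (w r j).2|))
        ≤ ENNReal.ofReal (C * k * ((R : ℝ) - (r : ℝ)) * V) := by
  intro r R hrR
  induction R, hrR using Nat.le_induction with
  | base => simp
  | succ R hR ih =>
    have hCk : 0 ≤ C * k := mul_nonneg hC hk.le
    have hsub : (0 : ℝ) ≤ (R : ℝ) - (r : ℝ) := by
      have : (r : ℝ) ≤ R := by exact_mod_cast hR
      linarith
    have key : ∀ j : ℤ,
        ENNReal.ofReal h * ENNReal.ofReal
            (|(w (R + 1) j).1 - (w r j).1| + |(w (R + 1) j).2 - (w r j).2|)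
          ≤ ENNReal.ofReal h * ENNReal.ofReal
              (|(w R j).1 - (w r j).1| + |(w R j).2 - (w r j).2|)
            + ENNReal.ofReal (C * k) * ENNReal.ofReal
              (|(w R j).1 - (w R (j - 1)).1| + |(w R j).2 - (w R (j - 1)).2|) := by
      intro j
      rw [← ENNReal.ofReal_mul hh.le, ← ENNReal.ofReal_mul hh.le, ← ENNReal.ofReal_mul hCk,
        ← ENNReal.ofReal_add (by positivity) (by positivity)]
      apply ENNReal.ofReal_le_ofReal
      have e : ∀ a b p : ℝ, h * |a + k / h * p - b| ≤ h * |a - b| + k * |p| := by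
        intro a b p
        have h1 : a + k / h * p - b = (a - b) + k / h * p := by ring
        have h2 : h * |k / h * p| = k * |p| := by
          rw [abs_mul, abs_of_pos (div_pos hk hh)]
          field_simp
        rw [h1, ← h2, ← mul_add]
        exact mul_le_mul_of_nonneg_left (abs_add_le _ _) hh.le
      have e1 := e (w R j).1 (w r j).1 ((P (w R j)).1 - (P (w R (j - 1))).1)
      have e2 := e (w R j).2 (w r j).2 ((P (w R j)).2 - (P (w R (j - 1))).2)
      have e3 := mul_le_mul_of_nonneg_left (hP (w R j) (w R (j - 1))) hk.le
      rw [hrec]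
      simp only [Prod.fst_add, Prod.snd_add, Prod.smul_fst, Prod.smul_snd, Prod.fst_sub,
        Prod.snd_sub, smul_eq_mul]
      linarith
    rw [← ENNReal.tsum_mul_left] at ih ⊢
    refine (ENNReal.tsum_le_tsum key).trans ?_
    rw [ENNReal.tsum_add, ENNReal.tsum_mul_left (a := ENNReal.ofReal (C * k))]
    refine (add_le_add ih (mul_le_mul_right (hTV R) _)).trans ?_
    rw [← ENNReal.ofReal_mul hCk, ← ENNReal.ofReal_add (by positivity) (by positivity)]
    apply ENNReal.ofReal_le_ofReal
    push_cast
    linarith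
end

section
/- Let T > 0 and let J ⊆ ℝ be an open interval. Let b : J → ℝ be continuously differentiable with b(s) > 0 and b'(s) ≠ 0 for all s ∈ J. Let u : ℝ × [0, T) → J be continuously differentiable and satisfy the quasilinear equation b'(u)·∂_t u + (u·b'(u) + b(u))·∂_x u = 0 everywhere. Let γ : ℝ × [0, T) → ℝ be twice continuously differentiable with γ(x, 0) = x, ∂_x γ(x, t) > 0, and ∂_t γ(x, t) = u(γ(x, t), t) for all (x, t). Then for all (x, t) ∈ ℝ × [0, T): ∂_x γ(x, t) · b(∂_t γ(x, t)) = b(u(x, 0)); equivalently, writing σ₀(x) = b(u(x,0)), the map γ satisfies the Hamilton–Jacobi-type equation ∂_t γ = F(σ₀(x)/∂_x γ) wherever F is the inverse function of b. -/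
set_option maxHeartbeats 2000000 in
/-- the classical weak-diffeomorphism equation: let `b` be `C¹` on an
open interval `J` with `b > 0` and `b' ≠ 0`, let `u` be a `C¹` solution taking values
in `J` of the quasilinear equation `b'(u)·u_t + (u·b'(u) + b(u))·u_x = 0` on
`ℝ × [0, T)`, and let `γ` be a `C²` particle-path flow: `γ(x,0) = x`, `γ_x > 0` and
`γ_t(x,t) = u(γ(x,t), t)`. Then `γ_x·b(γ_t) = b(u(·,0))`, which is the classical form
`γ_t = F(σ₀/γ_x)` (with `F = b⁻¹`, `σ₀ = b(u(·,0))`) of the Hamilton–Jacobi equation. -/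
theorem stmt14 (T : ℝ) (hT : 0 < T) (J : Set ℝ) (hJopen : IsOpen J) (hJconv : Convex ℝ J)
    (b : ℝ → ℝ) (hb : ContDiffOn ℝ 1 b J)
    (hbpos : ∀ s ∈ J, 0 < b s) (hb' : ∀ s ∈ J, deriv b s ≠ 0)
    (u : ℝ × ℝ → ℝ) (hu : ContDiffOn ℝ 1 u (Set.univ ×ˢ Set.Ico 0 T))
    (huJ : ∀ x t : ℝ, t ∈ Set.Ico 0 T → u (x, t) ∈ J)
    (hPDE : ∀ x t : ℝ, t ∈ Set.Ico 0 T →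
      deriv b (u (x, t)) * deriv (fun s => u (x, s)) t
        + (u (x, t) * deriv b (u (x, t)) + b (u (x, t)))
            * deriv (fun y => u (y, t)) x = 0)
    (γ : ℝ × ℝ → ℝ) (hγ : ContDiffOn ℝ 2 γ (Set.univ ×ˢ Set.Ico 0 T))
    (hγ0 : ∀ x : ℝ, γ (x, 0) = x)
    (hγx : ∀ x t : ℝ, t ∈ Set.Ico 0 T → 0 < deriv (fun y => γ (y, t)) x)
    (hγt : ∀ x t : ℝ, t ∈ Set.Ico 0 T →
      deriv (fun s => γ (x, s)) t = u (γ (x, t), t)) :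
    ∀ x t : ℝ, t ∈ Set.Ico 0 T →
      deriv (fun y => γ (y, t)) x * b (deriv (fun s => γ (x, s)) t) = b (u (x, 0)) := by
  intro x t ht
  have hS : ∀ y s : ℝ, s ∈ Set.Ico 0 T → ((y, s) : ℝ × ℝ) ∈ (Set.univ ×ˢ Set.Ico 0 T : Set (ℝ × ℝ)) :=
    fun y s hs => ⟨Set.mem_univ _, hs⟩
  have hUD : UniqueDiffOn ℝ (Set.univ ×ˢ Set.Ico 0 T : Set (ℝ × ℝ)) :=
    uniqueDiffOn_univ.prod (uniqueDiffOn_Ico 0 T)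
  have hsx : ∀ y s : ℝ, HasDerivAt (fun z : ℝ => ((z, s) : ℝ × ℝ)) (1, 0) y := fun y s =>
    (hasDerivAt_id y).prodMk (hasDerivAt_const y s)
  have hst : ∀ y s : ℝ, HasDerivAt (fun z : ℝ => ((y, z) : ℝ × ℝ)) (0, 1) s := fun y s =>
    (hasDerivAt_const s y).prodMk (hasDerivAt_id s)
  -- x-derivative as a within derivative
  have hgx : ∀ y s : ℝ, s ∈ Set.Ico 0 T →
      deriv (fun z => γ (z, s)) y
        = fderivWithin ℝ γ (Set.univ ×ˢ Set.Ico 0 T) (y, s) (1, 0) := by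
    intro y s hs
    have h1 := ((hγ.differentiableOn (by norm_num)) (y, s) (hS y s hs)).hasFDerivWithinAt
    have h2 : HasDerivWithinAt (fun z : ℝ => ((z, s) : ℝ × ℝ)) (1, 0) Set.univ y :=
      (hsx y s).hasDerivWithinAt
    have h3 := h1.comp_hasDerivWithinAt y h2 (fun z _ => hS z s hs)
    exact (hasDerivWithinAt_univ.1 h3).deriv
  rw [hγt x t ht]
  rcases eq_or_lt_of_le ht.1 with h0 | h0
  · subst h0
    have : (fun y => γ (y, 0)) = fun y => y := funext hγ0
    rw [this, hγ0]; simp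
  have hsub : Set.Icc 0 t ⊆ Set.Ico 0 T := fun s hs => ⟨hs.1, hs.2.trans_lt ht.2⟩
  have hlc : ContinuousOn (fun s : ℝ => ((x, s) : ℝ × ℝ)) (Set.Icc 0 t) := by fun_prop
  have hc1 : ContinuousOn (fun s => deriv (fun y => γ (y, s)) x) (Set.Icc 0 t) := by
    have h := (hγ.continuousOn_fderivWithin hUD (by norm_num)).comp hlc
      (fun s hs => hS x s (hsub hs))
    have h' := h.clm_apply (continuousOn_const (c := ((1, 0) : ℝ × ℝ)))
    exact h'.congr (fun s hs => hgx x s (hsub hs))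
  have hcγ : ContinuousOn (fun s => γ (x, s)) (Set.Icc 0 t) :=
    hγ.continuousOn.comp hlc (fun s hs => hS x s (hsub hs))
  have hcu : ContinuousOn (fun s => u (γ (x, s), s)) (Set.Icc 0 t) :=
    hu.continuousOn.comp (hcγ.prodMk continuousOn_id) (fun s hs => hS _ s (hsub hs))
  have hcb : ContinuousOn (fun s => b (u (γ (x, s), s))) (Set.Icc 0 t) :=
    hb.continuousOn.comp hcu (fun s hs => huJ _ s (hsub hs))
  have hder : ∀ s ∈ Set.Ioo 0 t,
      HasDerivAt (fun s => deriv (fun y => γ (y, s)) x * b (u (γ (x, s), s))) 0 s := by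
    intro s hs
    have hsI : s ∈ Set.Ico 0 T := hsub ⟨hs.1.le, hs.2.le⟩
    have hnhd : ∀ y : ℝ, (Set.univ ×ˢ Set.Ico 0 T : Set (ℝ × ℝ)) ∈ nhds (y, s) := fun y =>
      prod_mem_nhds Filter.univ_mem (Ico_mem_nhds hs.1 hsI.2)
    have hγ2 : ∀ y, ContDiffAt ℝ 2 γ (y, s) := fun y => hγ.contDiffAt (hnhd y)
    have hγd : ∀ y, HasFDerivAt γ (fderiv ℝ γ (y, s)) (y, s) := fun y =>
      ((hγ2 y).differentiableAt (by norm_num)).hasFDerivAt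
    have hud : ∀ y, HasFDerivAt u (fderiv ℝ u (y, s)) (y, s) := fun y =>
      ((hu.contDiffAt (hnhd y)).differentiableAt (by norm_num)).hasFDerivAt
    have hγX : ∀ y, HasDerivAt (fun z => γ (z, s)) (deriv (fun z => γ (z, s)) y) y := fun y =>
      ((hγd y).comp_hasDerivAt y (hsx y s)).differentiableAt.hasDerivAt
    have hγT : ∀ y, HasDerivAt (fun z => γ (y, z)) (fderiv ℝ γ (y, s) (0, 1)) s := fun y =>
      (hγd y).comp_hasDerivAt s (hst y s)
    have hγT' : ∀ y, fderiv ℝ γ (y, s) (0, 1) = u (γ (y, s), s) := fun y => by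
      rw [← hγt y s hsI]; exact (hγT y).deriv.symm
    have hux : ∀ y, fderiv ℝ u (y, s) (1, 0) = deriv (fun z => u (z, s)) y := fun y =>
      ((hud y).comp_hasDerivAt y (hsx y s)).deriv.symm
    have hut : ∀ y, fderiv ℝ u (y, s) (0, 1) = deriv (fun z => u (y, z)) s := fun y =>
      ((hud y).comp_hasDerivAt s (hst y s)).deriv.symm
    -- second derivative
    have hD : HasFDerivAt (fderiv ℝ γ) (fderiv ℝ (fderiv ℝ γ) (x, s)) (x, s) :=
      (((hγ2 x).fderiv_right (m := 1) (by norm_num)).differentiableAt (by norm_num)).hasFDerivAt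
    have hsymm := (hγ2 x).isSymmSndFDerivAt (by simp)
    have hA : HasDerivAt (fun y => fderiv ℝ γ (y, s) (0, 1))
        (fderiv ℝ (fderiv ℝ γ) (x, s) (1, 0) (0, 1)) x := by
      have := (hD.comp_hasDerivAt x (hsx x s)).clm_apply (hasDerivAt_const x ((0, 1) : ℝ × ℝ))
      simpa using this
    have hB : HasDerivAt (fun z => fderiv ℝ γ (x, z) (1, 0))
        (fderiv ℝ (fderiv ℝ γ) (x, s) (0, 1) (1, 0)) s := by
      have := (hD.comp_hasDerivAt s (hst x s)).clm_apply (hasDerivAt_const s ((1, 0) : ℝ × ℝ))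
      simpa using this
    have hA' : HasDerivAt (fun y => u (γ (y, s), s))
        (deriv (fun z => u (z, s)) (γ (x, s)) * deriv (fun z => γ (z, s)) x) x := by
      have h1 : HasDerivAt (fun z => u (z, s)) (deriv (fun z => u (z, s)) (γ (x, s))) (γ (x, s)) :=
        (HasFDerivAt.comp_hasDerivAt (f := fun z : ℝ => ((z, s) : ℝ × ℝ)) (γ (x, s)) (hud (γ (x, s))) (hsx (γ (x, s)) s)).differentiableAt.hasDerivAt
      exact h1.comp x (hγX x)
    have hmix : fderiv ℝ (fderiv ℝ γ) (x, s) (0, 1) (1, 0)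
        = deriv (fun z => u (z, s)) (γ (x, s)) * deriv (fun z => γ (z, s)) x := by
      rw [hsymm.eq (0, 1) (1, 0)]
      rw [funext hγT'] at hA
      exact hA.unique hA'
    have hC : HasDerivAt (fun z => deriv (fun y => γ (y, z)) x)
        (deriv (fun z => u (z, s)) (γ (x, s)) * deriv (fun z => γ (z, s)) x) s := by
      rw [← hmix]
      refine hB.congr_of_eventuallyEq ?_
      filter_upwards [Ioo_mem_nhds hs.1 hsI.2] with z hz
      rw [hgx x z ⟨hz.1.le, hz.2⟩, fderivWithin_of_mem_nhds]
      exact prod_mem_nhds Filter.univ_mem (Ico_mem_nhds hz.1 hz.2)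
    have hU : HasDerivAt (fun z => u (γ (x, z), z))
        (u (γ (x, s), s) * deriv (fun z => u (z, s)) (γ (x, s))
          + deriv (fun z => u (γ (x, s), z)) s) s := by
      have h1 : HasDerivAt (fun z => ((γ (x, z), z) : ℝ × ℝ)) (u (γ (x, s), s), 1) s := by
        have := (hγT x).prodMk (hasDerivAt_id s)
        rw [hγT'] at this
        exact this
      have h2 := HasFDerivAt.comp_hasDerivAt (f := fun z : ℝ => ((γ (x, z), z) : ℝ × ℝ)) s (hud (γ (x, s))) h1
      have h3 : ((u (γ (x, s), s), 1) : ℝ × ℝ)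
          = u (γ (x, s), s) • ((1, 0) : ℝ × ℝ) + (0, 1) := by simp
      rw [h3, map_add, map_smul, hux, hut, smul_eq_mul] at h2
      exact h2
    have hbd : HasDerivAt b (deriv b (u (γ (x, s), s))) (u (γ (x, s), s)) :=
      ((hb.contDiffAt (hJopen.mem_nhds (huJ _ s hsI))).differentiableAt
        (by norm_num)).hasDerivAt
    have hfin := hC.mul (hbd.comp s hU)
    refine hfin.congr_deriv ?_
    have hp := hPDE (γ (x, s)) s hsI
    simp only [Function.comp]
    linear_combination (deriv (fun z => γ (z, s)) x) * hp
  obtain ⟨c, hc, hc'⟩ := exists_hasDerivAt_eq_slope _ (fun _ => (0 : ℝ)) h0 (hc1.mul hcb) hder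
  have h00 : deriv (fun y => γ (y, 0)) x = 1 := by
    have : (fun y => γ (y, 0)) = fun y => y := funext hγ0
    rw [this]; simp
  have hne : t - 0 ≠ 0 := by linarith
  rw [eq_comm, div_eq_zero_iff] at hc'
  have := hc'.resolve_right hne
  simp only [Pi.mul_apply, hγ0, deriv_id''] at this
  linarith
end

section
/- Let 0 < m ≤ M, let G : (0,∞) → ℝ be twice continuously differentiable with G' > 0 on [m, M], set g(s) = s·G(s), and adopt the setup of the weak-solution recovery theorem: (η, v) bounded measurable on ℝ × [0,∞) with 0 < m' ≤ η ≤ M' and m ≤ v/η ≤ M, satisfying the weak formulation of the Temple system η_t − G(v/η)_x = 0, v_t = 0 with data (1, σ₀); γ : ℝ × [0,∞) → ℝ locally Lipschitz with γ(x,0) = x, x ↦ γ(x,t) a strictly increasing bijection of ℝ for each t, ∂_x γ = η and ∂_t γ = G(v/η) almost everywhere; and σ(y,t) = (v/η)(γ(·,t)⁻¹(y), t). Then for every continuously differentiable compactly supported φ : ℝ × ℝ → ℝ, the change-of-variables identity holds: ∫₀^∞ ∫_ℝ (∂_t φ(y,t)·σ(y,t) + ∂_x φ(y,t)·g(σ(y,t)))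 dy dt = ∫₀^∞ ∫_ℝ ∂_t(φ(γ(x,t), t))·v(x,t) dx dt; that is, after substituting (y,t) = (γ(x,t), t) all flux terms cancel and only the time-derivative term against v remains. -/
open MeasureTheory

lemma null_image_aux (f : ℝ → ℝ) (hf : LocallyLipschitz f) (s : Set ℝ) (hs : volume s = 0) :
    volume (f '' s) = 0 := by
  choose K t ht hK using hf
  obtain ⟨c, hc, hcov⟩ := TopologicalSpace.countable_cover_nhds (f := t) (fun x => ht x)
  have hsub : f '' s ⊆ ⋃ x ∈ c, f '' (s ∩ t x) := by
    rintro _ ⟨x, hx, rfl⟩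
    have : x ∈ ⋃ y ∈ c, t y := by rw [hcov]; trivial
    simp only [Set.mem_iUnion] at this ⊢
    obtain ⟨y, hy, hxy⟩ := this
    exact ⟨y, hy, x, ⟨hx, hxy⟩, rfl⟩
  refine measure_mono_null hsub ?_
  rw [measure_biUnion_null_iff hc]
  intro y hy
  have h1 := ((hK y).mono (Set.inter_subset_right (s := s))).hausdorffMeasure_image_le
    (d := 1) zero_le_one
  rw [hausdorffMeasure_real] at h1
  have h2 : volume (s ∩ t y) = 0 := measure_mono_null Set.inter_subset_left hs
  rw [h2, mul_zero] at h1
  exact le_antisymm h1 bot_le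

lemma cov_aux (f e F : ℝ → ℝ) (hf : LocallyLipschitz f) (hinj : Function.Injective f)
    (hsurj : Function.Surjective f) (he : ∀ x, 0 ≤ e x)
    (hd : ∀ᵐ x, HasDerivAt f (e x) x) :
    ∫ y, F y = ∫ x, e x * F (f x) := by
  obtain ⟨s, hs, hsm, hs0⟩ : ∃ s : Set ℝ, (∀ x ∈ s, HasDerivAt f (e x) x) ∧
      MeasurableSet s ∧ volume sᶜ = 0 := by
    refine ⟨(toMeasurable volume {x | ¬ HasDerivAt f (e x) x})ᶜ, ?_, 
      (measurableSet_toMeasurable _ _).compl, ?_⟩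
    · intro x hx
      by_contra h
      exact hx (subset_toMeasurable _ _ h)
    · rw [compl_compl, measure_toMeasurable]; exact hd
  have h := integral_image_eq_integral_abs_deriv_smul hsm
    (fun x hx => (hs x hx).hasDerivWithinAt) (hinj.injOn) F
  have h1 : (f '' s) =ᵐ[volume] Set.univ := by
    rw [ae_eq_univ, ← Set.image_compl_eq ⟨hinj, hsurj⟩]
    exact null_image_aux f hf _ hs0
  have h2 : s =ᵐ[volume] Set.univ := ae_eq_univ.2 hs0
  rw [setIntegral_congr_set h1, setIntegral_congr_set h2, setIntegral_univ,
    setIntegral_univ] at h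
  rw [h]
  simp only [abs_of_nonneg (he _), smul_eq_mul]

/-- the change-of-variables cancellation identity: in the setup of
the recovery theorem, for every test function `φ`, substituting `(y,t) = (γ(x,t), t)`
in `∫∫ (φ_t·σ + φ_x·g(σ))` (with `σ = (v/η) ∘ γ(·,t)⁻¹`, `g(s) = s·G(s)`) cancels all
flux terms and leaves only `∫∫ ∂_t(φ(γ(x,t), t))·v(x,t)`. -/
theorem stmt15 (m M m' M' : ℝ) (hm : 0 < m) (hmM : m ≤ M) (hm' : 0 < m') (hm'M' : m' ≤ M')
    (G : ℝ → ℝ) (hG : ContDiffOn ℝ 2 G (Set.Ioi 0))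
    (hG' : ∀ s ∈ Set.Icc m M, 0 < deriv G s)
    (σ₀ : ℝ → ℝ) (hσ₀meas : Measurable σ₀) (hσ₀ : ∀ x, σ₀ x ∈ Set.Icc m M)
    (η v : ℝ × ℝ → ℝ) (hηmeas : Measurable η) (hvmeas : Measurable v)
    (hηbd : ∀ x t : ℝ, 0 ≤ t → η (x, t) ∈ Set.Icc m' M')
    (hratio : ∀ x t : ℝ, 0 ≤ t → v (x, t) / η (x, t) ∈ Set.Icc m M)
    (hweak1 : ∀ φ : ℝ × ℝ → ℝ, ContDiff ℝ 1 φ → HasCompactSupport φ →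
      (∫ t in Set.Ioi (0 : ℝ), ∫ x : ℝ,
          (deriv (fun s => φ (x, s)) t * η (x, t)
            - deriv (fun y => φ (y, t)) x * G (v (x, t) / η (x, t))))
        + ∫ x : ℝ, φ (x, 0) = 0)
    (hweak2 : ∀ φ : ℝ × ℝ → ℝ, ContDiff ℝ 1 φ → HasCompactSupport φ →
      (∫ t in Set.Ioi (0 : ℝ), ∫ x : ℝ, deriv (fun s => φ (x, s)) t * v (x, t))
        + ∫ x : ℝ, φ (x, 0) * σ₀ x = 0)
    (γ : ℝ × ℝ → ℝ) (hγlip : LocallyLipschitz γ)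
    (hγ0 : ∀ x : ℝ, γ (x, 0) = x)
    (hγmono : ∀ t : ℝ, 0 ≤ t → StrictMono (fun x => γ (x, t)))
    (hγsurj : ∀ t : ℝ, 0 ≤ t → Function.Surjective (fun x => γ (x, t)))
    (hγx : ∀ᵐ p : ℝ × ℝ ∂(volume.restrict {p : ℝ × ℝ | 0 < p.2}),
      HasDerivAt (fun y => γ (y, p.2)) (η p) p.1)
    (hγt : ∀ᵐ p : ℝ × ℝ ∂(volume.restrict {p : ℝ × ℝ | 0 < p.2}),
      HasDerivAt (fun s => γ (p.1, s)) (G (v p / η p)) p.2) :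
    ∀ φ : ℝ × ℝ → ℝ, ContDiff ℝ 1 φ → HasCompactSupport φ →
      (∫ t in Set.Ioi (0 : ℝ), ∫ y : ℝ,
          (deriv (fun s => φ (y, s)) t *
              (v (Function.invFun (fun x => γ (x, t)) y, t) /
                η (Function.invFun (fun x => γ (x, t)) y, t))
            + deriv (fun z => φ (z, t)) y *
              ((v (Function.invFun (fun x => γ (x, t)) y, t) /
                  η (Function.invFun (fun x => γ (x, t)) y, t)) *
                G (v (Function.invFun (fun x => γ (x, t)) y, t) /
                  η (Function.invFun (fun x => γ (x, t)) y, t)))))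
        = ∫ t in Set.Ioi (0 : ℝ), ∫ x : ℝ,
            deriv (fun s => φ (γ (x, s), s)) t * v (x, t) := by
  intro φ hφ _
  have key : ∀ᵐ t : ℝ, 0 < t → ∀ᵐ x : ℝ, HasDerivAt (fun y => γ (y, t)) (η (x, t)) x ∧
      HasDerivAt (fun s => γ (x, s)) (G (v (x, t) / η (x, t))) t := by
    have hS : MeasurableSet {p : ℝ × ℝ | 0 < p.2} := measurableSet_lt measurable_const measurable_snd
    have h0 := hγx.and hγt
    rw [ae_restrict_iff' hS] at h0
    have h1 := (Measure.measurePreserving_swap (μ := (volume : Measure ℝ))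
      (ν := (volume : Measure ℝ))).quasiMeasurePreserving.ae h0
    have h2 := Measure.ae_ae_of_ae_prod h1
    filter_upwards [h2] with t ht htpos
    filter_upwards [ht] with x hx
    exact hx htpos
  refine setIntegral_congr_ae measurableSet_Ioi ?_
  filter_upwards [key] with t ht htpos
  have htp : 0 < t := htpos
  specialize ht htp
  have hinj := (hγmono t htp.le).injective
  have hlip : LocallyLipschitz (fun x => γ (x, t)) :=
    hγlip.comp (LipschitzWith.prodMk_right t).locallyLipschitz
  have hηpos : ∀ x, 0 < η (x, t) := fun x => hm'.trans_le (hηbd x t htp.le).1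
  rw [cov_aux (fun x => γ (x, t)) (fun x => η (x, t)) _ hlip hinj (hγsurj t htp.le)
    (fun x => (hηpos x).le) (ht.mono fun x hx => hx.1)]
  refine integral_congr_ae ?_
  filter_upwards [ht] with x hx
  have hinv : Function.invFun (fun x => γ (x, t)) (γ (x, t)) = x :=
    Function.leftInverse_invFun hinj x
  have hφd : HasFDerivAt φ (fderiv ℝ φ (γ (x, t), t)) (γ (x, t), t) :=
    (hφ.differentiable one_ne_zero _).hasFDerivAt
  have d1 : HasDerivAt (fun s => φ (γ (x, t), s)) (fderiv ℝ φ (γ (x, t), t) (0, 1)) t :=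
    hφd.comp_hasDerivAt t ((hasDerivAt_const t (γ (x, t))).prodMk (hasDerivAt_id t))
  have d2 : HasDerivAt (fun z => φ (z, t)) (fderiv ℝ φ (γ (x, t), t) (1, 0)) (γ (x, t)) :=
    hφd.comp_hasDerivAt (γ (x, t)) ((hasDerivAt_id _).prodMk (hasDerivAt_const _ t))
  have d3 : HasDerivAt (fun s => φ (γ (x, s), s))
      (fderiv ℝ φ (γ (x, t), t) (G (v (x, t) / η (x, t)), 1)) t :=
    HasFDerivAt.comp_hasDerivAt (f := fun s => (γ (x, s), s)) t hφd
      (hx.2.prodMk (hasDerivAt_id t))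
  have hlin : fderiv ℝ φ (γ (x, t), t) (G (v (x, t) / η (x, t)), 1) =
      G (v (x, t) / η (x, t)) * fderiv ℝ φ (γ (x, t), t) (1, 0)
        + fderiv ℝ φ (γ (x, t), t) (0, 1) := by
    rw [← smul_eq_mul, ← map_smul, ← map_add]
    simp
  simp only [hinv, d1.deriv, d2.deriv, d3.deriv, hlin]
  have := (hηpos x).ne'
  generalize G (v (x, t) / η (x, t)) = g
  field_simp
  ring
end
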